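/- arXiv:2406.01856 — 6 statements merged into one kernel-verified Lean document; each statement's English description precedes it below -/
import Mathlib

section
/- For every real y with −1 ≤ y ≤ 1, arccos(y)/π ≥ (0.878/2)·(1 − y). -/
open Real in
/-- Near the contact point `3π/4`, `cos u + sin u` is bounded by a quadratic. -/
theorem cos_add_sin_le_quadratic {u : ℝ} (hl : -0.96 ≤ u) (hr : u ≤ 0.96) :
    cos u + sin u ≤ 1 + u - 0.29 * u ^ 2 := by
  have hu : |u| ≤ 1 := abs_le.2 ⟨by linarith, by linarith⟩
  have hc := (abs_le.1 (cos_bound hu)).2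
  have h4 : |u| ^ 4 = u ^ 4 := by rw [← abs_pow, abs_of_nonneg (by positivity)]
  rw [h4] at hc
  have hsq : u ^ 2 ≤ 0.96 ^ 2 := sq_le_sq' (by linarith) hr
  have hs : sin u ≤ u + 0.16 * u ^ 2 := by
    rcases le_total 0 u with h | h
    · nlinarith [sin_le h]
    · have := sin_ge_sub_cube (neg_nonneg.2 h)
      rw [sin_neg] at this
      nlinarith [mul_nonneg (sq_nonneg u) (by linarith : (0 : ℝ) ≤ u + 0.96)]
  nlinarith [mul_nonneg (sq_nonneg u) (sub_nonneg.2 hsq)]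

open Real in
theorem one_sub_cos_mul_le {θ : ℝ} (h0 : 0 ≤ θ) (hπ : θ ≤ π) :
    0.439 * π * (1 - cos θ) ≤ θ := by
  have p1 := pi_gt_d4
  have p2 := pi_lt_d4
  rcases le_total θ 1.4 with h | h
  · have hc := one_sub_sq_div_two_le_cos (x := θ)
    calc 0.439 * π * (1 - cos θ) ≤ 0.439 * 3.1416 * (θ ^ 2 / 2) := by
          gcongr
          · linarith [cos_le_one θ]
          · linarith
      _ ≤ θ := by nlinarith
  · obtain ⟨u, rfl⟩ : ∃ u, θ = u + (π - π / 4) := ⟨θ - (π - π / 4), by ring⟩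
    have hcos : cos (u + (π - π / 4)) = -(√2 / 2 * (cos u + sin u)) := by
      rw [cos_add, cos_pi_sub, sin_pi_sub, cos_pi_div_four, sin_pi_div_four]
      ring
    have hq := cos_add_sin_le_quadratic (u := u) (by linarith) (by linarith)
    have s1 : 1.41421 ≤ √2 := le_sqrt_of_sq_le (by norm_num)
    have s2 : √2 ≤ 1.41422 := sqrt_le_iff.2 ⟨by norm_num, by norm_num⟩
    have hb : √2 / 2 * (cos u + sin u) ≤ 0.70711 + √2 / 2 * u - 0.205 * u ^ 2 := by
      nlinarith [mul_le_mul_of_nonneg_left hq (by positivity : 0 ≤ √2 / 2),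
        mul_nonneg (sub_nonneg.2 s1) (sq_nonneg u)]
    have hc : 1 - cos (u + (π - π / 4)) ≤ 1.7072 + 0.7071 * u - 0.2 * u ^ 2 := by
      rw [hcos]
      rcases le_total 0 u with h | h <;> nlinarith
    have hm := mul_le_mul_of_nonneg_left hc (by positivity : 0 ≤ 0.439 * π)
    have hk : 0.439 * π * (1.7072 + 0.7071 * u - 0.2 * u ^ 2) ≤ u + (π - π / 4) := by
      nlinarith [mul_nonneg (sub_nonneg.2 p1.le) (sq_nonneg u), sq_nonneg (u + 0.04)]
    linarith

/-- For every `y ∈ [-1, 1]`, `arccos(y)/π ≥ (0.878/2)·(1 - y)`. -/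
theorem arccos_div_pi_ge (y : ℝ) (h1 : -1 ≤ y) (h2 : y ≤ 1) :
    Real.arccos y / Real.pi ≥ (0.878 / 2) * (1 - y) := by
  have h := one_sub_cos_mul_le (Real.arccos_nonneg y) (Real.arccos_le_pi y)
  rw [Real.cos_arccos h1 h2] at h
  rw [ge_iff_le, le_div_iff₀ Real.pi_pos]
  linarith
end

section
/- Let n ≥ 2, let σ be the uniform (normalized rotation-invariant) probability measure on the unit sphere of ℝ^n, and let u, v, w be unit vectors in ℝ^n. Then σ({r on the unit sphere : sgn(⟨u,r⟩) = sgn(⟨v,r⟩) = sgn(⟨w,r⟩)}) = 1 − (1/(2π))·(arccos(⟨u,v⟩) + arccos(⟨u,w⟩) + arccos(⟨v,w⟩)), where sgn(t) = 1 if t ≥ 0 and sgn(t) = −1 if t < 0. -/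
open RealInnerProductSpace MeasureTheory

/-- The sign function used in Goemans–Williamson rounding: `1` if `t ≥ 0`, `-1` otherwise. -/
noncomputable def gwSgn (t : ℝ) : ℝ := if 0 ≤ t then 1 else -1

/-- A bounded function on `[0, L]` that is additive and vanishes at `L` is identically zero. -/
theorem eq_zero_of_additive_of_bounded {G : ℝ → ℝ} {L C : ℝ}
    (hbound : ∀ t, 0 ≤ t → t ≤ L → |G t| ≤ C)
    (hadd : ∀ s t, 0 ≤ s → 0 ≤ t → s + t ≤ L → G (s + t) = G s + G t) (hL : G L = 0)
    {t : ℝ} (ht0 : 0 ≤ t) (htL : t ≤ L) : G t = 0 := by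
  have hdouble : ∀ t, 0 ≤ t → t ≤ L → ∃ t', 0 ≤ t' ∧ t' ≤ L ∧ |G t'| = 2 * |G t| := by
    intro t h0 h1
    rcases le_total (t + t) L with h | h
    · refine ⟨t + t, by linarith, h, ?_⟩
      rw [hadd t t h0 h0 h, ← two_mul, abs_mul, abs_two]
    · have h2 := hadd (L - t) t (by linarith) h0 (by linarith)
      have h3 := hadd (L - t) (L - t) (by linarith) (by linarith) (by linarith)
      rw [sub_add_cancel, hL] at h2
      refine ⟨(L - t) + (L - t), by linarith, by linarith, ?_⟩
      rw [h3, show G (L - t) = -G t by linarith, ← two_mul, abs_mul, abs_two, abs_neg]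
  have hpow : ∀ k : ℕ, ∀ t, 0 ≤ t → t ≤ L → 2 ^ k * |G t| ≤ C := by
    intro k
    induction k with
    | zero => simpa using hbound
    | succ k ih =>
      intro t h0 h1
      obtain ⟨t', h0', h1', h⟩ := hdouble t h0 h1
      have := ih t' h0' h1'
      rw [h] at this
      rw [pow_succ]
      linarith
  by_contra hne
  have hpos : 0 < |G t| := abs_pos.mpr hne
  obtain ⟨k, hk⟩ := pow_unbounded_of_one_lt (C / |G t|) (one_lt_two : (1 : ℝ) < 2)
  rw [div_lt_iff₀ hpos] at hk
  exact absurd (hpow k t ht0 htL) (not_le.mpr hk)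

theorem measurable_gwSgn : Measurable gwSgn :=
  Measurable.ite measurableSet_Ici measurable_const measurable_const

theorem gwSgn_eq_iff {s t : ℝ} : gwSgn s = gwSgn t ↔ (0 ≤ s ↔ 0 ≤ t) := by
  unfold gwSgn
  split_ifs with h1 h2 h2 <;> norm_num [h1, h2]

section Separation

variable {E : Type*} [NormedAddCommGroup E] [InnerProductSpace ℝ E]

/-- The set of `r` whose orthogonal hyperplane separates `u` and `v`. -/
def separatingSet (u v : E) : Set E := {r | gwSgn ⟪u, r⟫ ≠ gwSgn ⟪v, r⟫}

theorem separatingSet_comm (u v : E) : separatingSet u v = separatingSet v u := by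
  ext r
  exact ne_comm

/-- `u` and `w` are separated when exactly one of the pairs `u`, `v` and `v`, `w` is. -/
theorem separatingSet_eq_sdiff (u v w : E) :
    separatingSet u w = (separatingSet u v ∪ separatingSet v w) \
      (separatingSet u v ∩ separatingSet v w) := by
  ext r
  simp only [separatingSet, Set.mem_sdiff, Set.mem_union, Set.mem_inter_iff, Set.mem_ofPred_eq,
    ne_eq, gwSgn_eq_iff]
  tauto

/-- The point at angle `t` on the circle spanned by `e₁` and `e₂`. -/
noncomputable def circlePoint (e₁ e₂ : E) (t : ℝ) : E := Real.cos t • e₁ + Real.sin t • e₂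

theorem exists_isometry_circlePoint {e₁ e₂ : E} (h₁ : ‖e₁‖ = 1) (h₂ : ‖e₂‖ = 1)
    (h₁₂ : ⟪e₁, e₂⟫ = 0) (c : ℝ) :
    ∃ O : E ≃ₗᵢ[ℝ] E, ∀ t, O (circlePoint e₁ e₂ t) = circlePoint e₁ e₂ (c - t) := by
  have hinner : ∀ s t, ⟪circlePoint e₁ e₂ s, circlePoint e₁ e₂ t⟫ = Real.cos (s - t) := by
    intro s t
    simp only [circlePoint, inner_add_left, inner_add_right, real_inner_smul_left,
      real_inner_smul_right, real_inner_self_eq_norm_sq, h₁, h₂, h₁₂,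
      real_inner_comm e₁ e₂, Real.cos_sub]
    ring
  have hnorm : ‖circlePoint e₁ e₂ (c / 2)‖ ^ 2 = 1 := by
    rw [← real_inner_self_eq_norm_sq, hinner, sub_self, Real.cos_zero]
  refine ⟨Submodule.reflection (Submodule.span ℝ {circlePoint e₁ e₂ (c / 2)}), fun t => ?_⟩
  rw [Submodule.reflection_singleton_apply, hinner]
  simp only [RCLike.ofReal_real_eq_id, id, hnorm, div_one]
  have hcos : Real.cos (c - t) = 2 * Real.cos (c / 2 - t) * Real.cos (c / 2) - Real.cos t := by
    have h := Real.cos_add (c / 2 - t) (c / 2)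
    have h' := Real.cos_sub (c / 2 - t) (c / 2)
    rw [show c / 2 - t + c / 2 = c - t by ring] at h
    rw [show c / 2 - t - c / 2 = -t by ring, Real.cos_neg] at h'
    linarith
  have hsin : Real.sin (c - t) = 2 * Real.cos (c / 2 - t) * Real.sin (c / 2) - Real.sin t := by
    have h := Real.sin_add (c / 2 - t) (c / 2)
    have h' := Real.sin_sub (c / 2 - t) (c / 2)
    rw [show c / 2 - t + c / 2 = c - t by ring] at h
    rw [show c / 2 - t - c / 2 = -t by ring, Real.sin_neg] at h'
    linarith
  rw [circlePoint, circlePoint, circlePoint, hcos, hsin]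
  module

/-- In dimension at least two, `v` lies at angle `arccos ⟪u, v⟫` on a circle starting at `u`. -/
theorem exists_eq_circlePoint (hdim : 2 ≤ Module.finrank ℝ E) {u v : E}
    (hu : ‖u‖ = 1) (hv : ‖v‖ = 1) :
    ∃ e : E, ‖e‖ = 1 ∧ ⟪u, e⟫ = 0 ∧ v = circlePoint u e (Real.arccos ⟪u, v⟫) := by
  have habs := abs_le.mp (abs_real_inner_le_norm u v)
  rw [hu, hv, one_mul] at habs
  have hcos : Real.cos (Real.arccos ⟪u, v⟫) = ⟪u, v⟫ := Real.cos_arccos habs.1 habs.2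
  set θ := Real.arccos ⟪u, v⟫
  have horth : ⟪u, v - Real.cos θ • u⟫ = 0 := by
    rw [inner_sub_right, real_inner_smul_right, real_inner_self_eq_norm_sq, hu, hcos]
    ring
  have hnorm : ‖v - Real.cos θ • u‖ = Real.sin θ := by
    have h0 : 0 ≤ Real.sin θ := Real.sin_nonneg_of_nonneg_of_le_pi (Real.arccos_nonneg _)
      (Real.arccos_le_pi _)
    have h1 : ‖v - Real.cos θ • u‖ ^ 2 = Real.sin θ ^ 2 := by
      rw [norm_sub_sq_real, real_inner_smul_right, real_inner_comm, norm_smul, hu, hv, hcos,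
        Real.sin_sq, hcos, Real.norm_eq_abs, mul_one, sq_abs]
      ring
    exact (sq_eq_sq₀ (norm_nonneg _) h0).mp h1
  by_cases hs : Real.sin θ = 0
  · have hvu : v = Real.cos θ • u := by
      rw [hs, norm_eq_zero, sub_eq_zero] at hnorm
      exact hnorm
    have hspan : (Submodule.span ℝ {u})ᗮ ≠ ⊥ := by
      intro hbot
      have : FiniteDimensional ℝ E := FiniteDimensional.of_finrank_pos (by omega)
      have h := Submodule.finrank_add_finrank_orthogonal (Submodule.span ℝ {u})
      rw [hbot, finrank_bot, finrank_span_singleton (by rintro rfl; simp at hu)] at h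
      omega
    obtain ⟨x, hx, hx0⟩ := Submodule.exists_mem_ne_zero_of_ne_bot hspan
    refine ⟨‖x‖⁻¹ • x, ?_, ?_, ?_⟩
    · rw [norm_smul, norm_inv, norm_norm, inv_mul_cancel₀ (norm_ne_zero_iff.mpr hx0)]
    · rw [real_inner_smul_right, Submodule.mem_orthogonal_singleton_iff_inner_right.mp hx,
        mul_zero]
    · rw [circlePoint, hs, zero_smul, add_zero, ← hvu]
  · refine ⟨(Real.sin θ)⁻¹ • (v - Real.cos θ • u), ?_, ?_, ?_⟩
    · rw [norm_smul, norm_inv, hnorm, Real.norm_eq_abs, ← hnorm, abs_norm, hnorm,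
        inv_mul_cancel₀ hs]
    · rw [real_inner_smul_right, horth, mul_zero]
    · rw [circlePoint, smul_inv_smul₀ hs]
      abel

variable [FiniteDimensional ℝ E] [MeasurableSpace E] [BorelSpace E]

theorem measurableSet_separatingSet (u v : E) : MeasurableSet (separatingSet u v) := by
  have h : ∀ x : E, Measurable fun r : E => gwSgn ⟪x, r⟫ := fun x =>
    measurable_gwSgn.comp (by fun_prop)
  exact (measurableSet_eq_fun (h u) (h v)).compl

/-- Hyperplanes through the origin are null for a rotation-invariant probability measure without
an atom at the origin. -/
theorem measure_hyperplane_eq_zero {σ : Measure E} [IsProbabilityMeasure σ] (h0 : σ {0} = 0)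
    (hinv : ∀ O : E ≃ₗᵢ[ℝ] E, σ.map O = σ) {u : E} (hu : u ≠ 0) :
    σ {r | ⟪u, r⟫ = 0} = 0 := by
  have : Nontrivial E := ⟨u, 0, hu⟩
  have hmeas : MeasurableSet {p : E × E | ⟪p.1, p.2⟫ = 0} :=
    (isClosed_eq (by fun_prop) continuous_const).measurableSet
  have hnull : (volume : Measure E).prod σ {p : E × E | ⟪p.1, p.2⟫ = 0} = 0 := by
    rw [Measure.prod_apply_symm hmeas, lintegral_eq_zero_iff (measurable_measure_prodMk_right hmeas)]
    have hne : ∀ᵐ r ∂σ, r ≠ 0 := by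
      rw [ae_iff]
      simpa using h0
    filter_upwards [hne] with r hr
    have hset : (fun x => (x, r)) ⁻¹' {p : E × E | ⟪p.1, p.2⟫ = 0}
        = ((Submodule.span ℝ {r})ᗮ : Submodule ℝ E) := by
      ext x
      simp [Submodule.mem_orthogonal_singleton_iff_inner_left]
    rw [hset]
    refine Measure.addHaar_submodule _ _ fun htop => hr ?_
    have hmem : r ∈ (Submodule.span ℝ {r})ᗮ := htop ▸ Submodule.mem_top
    exact inner_self_eq_zero.mp (Submodule.mem_orthogonal_singleton_iff_inner_left.mp hmem)
  have hae : ∀ᵐ x : E, σ {r | ⟪x, r⟫ = 0} = 0 := Measure.measure_ae_null_of_prod_null hnull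
  have hne : ∀ᵐ x : E, x ≠ 0 := by
    rw [ae_iff]
    simp
  obtain ⟨x, hx, hx0⟩ := (hae.and hne).exists
  have hc : ‖u‖ / ‖x‖ ≠ 0 := div_ne_zero (norm_ne_zero_iff.mpr hu) (norm_ne_zero_iff.mpr hx0)
  have hnorm : ‖(‖u‖ / ‖x‖) • x‖ = ‖u‖ := by
    rw [norm_smul, norm_div, norm_norm, norm_norm, div_mul_cancel₀ _ (norm_ne_zero_iff.mpr hx0)]
  set O := Submodule.reflection (Submodule.span ℝ {(‖u‖ / ‖x‖) • x - u})ᗮ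
  have hO : O ((‖u‖ / ‖x‖) • x) = u := Submodule.reflection_sub hnorm
  rw [← hinv O, Measure.map_apply O.continuous.measurable
    (isClosed_eq (by fun_prop) continuous_const).measurableSet]
  convert hx using 2
  ext r
  rw [Set.mem_preimage, Set.mem_ofPred_eq, Set.mem_ofPred_eq, ← hO, O.inner_map_map,
    real_inner_smul_left]
  simp only [mul_eq_zero, hc, false_or]

theorem measureReal_separatingSet_map {σ : Measure E} {O : E ≃ₗᵢ[ℝ] E} (hO : σ.map O = σ)
    (u v : E) : σ.real (separatingSet (O u) (O v)) = σ.real (separatingSet u v) := by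
  conv_lhs => rw [← hO]
  rw [map_measureReal_apply O.continuous.measurable (measurableSet_separatingSet _ _)]
  congr 1
  ext r
  simp [separatingSet]

/-- The probability that a uniformly random hyperplane separates two unit vectors is
proportional to their angle. -/
theorem measureReal_separatingSet (hdim : 2 ≤ Module.finrank ℝ E) {σ : Measure E}
    [IsProbabilityMeasure σ] (h0 : σ {0} = 0) (hinv : ∀ O : E ≃ₗᵢ[ℝ] E, σ.map O = σ)
    {u v : E} (hu : ‖u‖ = 1) (hv : ‖v‖ = 1) :
    σ.real (separatingSet u v) = Real.arccos ⟪u, v⟫ / Real.pi := by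
  obtain ⟨e, he, hue, hve⟩ := exists_eq_circlePoint hdim hu hv
  have hplane := measure_hyperplane_eq_zero h0 hinv (u := u) (by rintro rfl; simp at hu)
  have hzero : circlePoint u e 0 = u := by simp [circlePoint]
  have hpi : circlePoint u e Real.pi = -u := by simp [circlePoint]
  set F : ℝ → ℝ := fun t => σ.real (separatingSet u (circlePoint u e t)) with hF
  have hshift : ∀ s t, σ.real (separatingSet (circlePoint u e s) (circlePoint u e (s + t)))
      = F t := by
    intro s t
    obtain ⟨O, hO⟩ := exists_isometry_circlePoint hu he hue (s + t)
    rw [← measureReal_separatingSet_map (hinv O), hO, hO, sub_self, hzero, separatingSet_comm,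
      add_sub_cancel_left]
  have hinter : ∀ s t, 0 ≤ s → 0 ≤ t → s + t ≤ Real.pi →
      σ.real (separatingSet u (circlePoint u e s) ∩
        separatingSet (circlePoint u e s) (circlePoint u e (s + t))) = 0 := by
    intro s t hs ht hst
    rw [measureReal_eq_zero_iff]
    refine measure_mono_null (fun r hr => ?_) hplane
    obtain ⟨h1, h2⟩ := hr
    by_contra hr0
    simp only [separatingSet, Set.mem_ofPred_eq, ne_eq, gwSgn_eq_iff] at h1 h2 hr0
    have hcomb : Real.sin (s + t) * ⟪circlePoint u e s, r⟫
        = Real.sin t * ⟪u, r⟫ + Real.sin s * ⟪circlePoint u e (s + t), r⟫ := by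
      simp only [circlePoint, inner_add_left, real_inner_smul_left, Real.sin_add, Real.cos_add]
      linear_combination (Real.sin t * ⟪u, r⟫) * Real.sin_sq_add_cos_sq s
    have hsin_s : 0 ≤ Real.sin s := Real.sin_nonneg_of_nonneg_of_le_pi hs (by linarith)
    have hsin_t : 0 ≤ Real.sin t := Real.sin_nonneg_of_nonneg_of_le_pi ht (by linarith)
    rcases hst.eq_or_lt with hst | hst
    · rw [hst, hpi, inner_neg_left] at h2
      rcases lt_or_gt_of_ne hr0 with h | h
      · have h3 : ¬ 0 ≤ ⟪u, r⟫ := by linarith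
        have h4 : 0 ≤ -⟪u, r⟫ := by linarith
        tauto
      · have h3 : 0 ≤ ⟪u, r⟫ := by linarith
        have h4 : ¬ 0 ≤ -⟪u, r⟫ := by linarith
        tauto
    · rcases hs.eq_or_lt with rfl | hs
      · rw [hzero] at h1
        exact h1 Iff.rfl
      have hsin : 0 < Real.sin (s + t) := Real.sin_pos_of_pos_of_lt_pi (by linarith) hst
      have hsin_s' : 0 < Real.sin s := Real.sin_pos_of_pos_of_lt_pi hs (by linarith)
      by_cases ha : 0 ≤ ⟪u, r⟫
      · have hc : 0 ≤ ⟪circlePoint u e (s + t), r⟫ := by tauto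
        have hb : ¬ 0 ≤ ⟪circlePoint u e s, r⟫ := by tauto
        nlinarith [mul_nonneg hsin_t ha, mul_nonneg hsin_s hc,
          mul_pos hsin (neg_pos.mpr (not_le.mp hb))]
      · have hc : ¬ 0 ≤ ⟪circlePoint u e (s + t), r⟫ := by tauto
        have hb : 0 ≤ ⟪circlePoint u e s, r⟫ := by tauto
        nlinarith [mul_nonneg hsin_t (neg_nonneg.mpr (not_le.mp ha).le),
          mul_pos hsin_s' (neg_pos.mpr (not_le.mp hc)), mul_nonneg hsin.le hb]
  have hFadd : ∀ s t, 0 ≤ s → 0 ≤ t → s + t ≤ Real.pi → F (s + t) = F s + F t := by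
    intro s t hs ht hst
    have hI := hinter s t hs ht hst
    have hU := measureReal_union_add_inter (μ := σ) (s := separatingSet u (circlePoint u e s))
      (measurableSet_separatingSet (circlePoint u e s) (circlePoint u e (s + t)))
    rw [hI, hshift, add_zero] at hU
    rw [← hU]
    change σ.real (separatingSet u _) = _
    rw [separatingSet_eq_sdiff u (circlePoint u e s), measureReal_def, measureReal_def,
      measure_sdiff_null ((measureReal_eq_zero_iff).mp hI)]
  have hFpi : F Real.pi = 1 := by
    rw [hF]
    simp only [hpi]
    have hcompl : σ (separatingSet u (-u))ᶜ = 0 := by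
      refine measure_mono_null (fun r hr => ?_) hplane
      simp only [separatingSet, Set.mem_compl_iff, Set.mem_ofPred_eq, ne_eq, not_not,
        gwSgn_eq_iff, inner_neg_left] at hr ⊢
      rcases le_total 0 ⟪u, r⟫ with h | h
      · linarith [hr.mp h]
      · linarith [hr.mpr (by linarith)]
    rw [measureReal_def, (prob_compl_eq_zero_iff (measurableSet_separatingSet _ _)).mp hcompl,
      ENNReal.toReal_one]
  have key := eq_zero_of_additive_of_bounded (G := fun t => F t - t / Real.pi) (L := Real.pi)
    (C := 1) (fun t h h' => ?_) (fun s t hs ht hst => ?_) ?_ (Real.arccos_nonneg ⟪u, v⟫)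
    (Real.arccos_le_pi _)
  · simp only [hF, ← hve] at key
    linarith
  · have hF0 : 0 ≤ F t := measureReal_nonneg
    have hF1 : F t ≤ 1 := measureReal_le_one
    have h3 : 0 ≤ t / Real.pi := div_nonneg h Real.pi_pos.le
    have h4 : t / Real.pi ≤ 1 := (div_le_one Real.pi_pos).mpr h'
    exact abs_le.mpr ⟨by linarith, by linarith⟩
  · simp only [hFadd s t hs ht hst]
    ring
  · simp only [hFpi, div_self Real.pi_ne_zero, sub_self]

end Separation

/-- Goemans–Williamson three-vector random-hyperplane lemma: for the uniform
(rotation-invariant, normalized) probability measure `σ` on the unit sphere of `ℝ^n`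
(encoded as a probability measure on `ℝ^n` supported on the unit sphere and invariant
under every linear isometry) and unit vectors `u, v, w`, the probability that all three
signs agree is `1 - (1/(2π))(arccos⟨u,v⟩ + arccos⟨u,w⟩ + arccos⟨v,w⟩)`. -/
theorem gw_hyperplane_three_prob (n : ℕ) (hn : 2 ≤ n)
    (σ : Measure (EuclideanSpace ℝ (Fin n))) (hσprob : IsProbabilityMeasure σ)
    (hσsupp : σ (Metric.sphere (0 : EuclideanSpace ℝ (Fin n)) 1)ᶜ = 0)
    (hσinv : ∀ O : EuclideanSpace ℝ (Fin n) ≃ₗᵢ[ℝ] EuclideanSpace ℝ (Fin n),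
      σ.map O = σ)
    (u v w : EuclideanSpace ℝ (Fin n)) (hu : ‖u‖ = 1) (hv : ‖v‖ = 1) (hw : ‖w‖ = 1) :
    σ {r | gwSgn ⟪u, r⟫ = gwSgn ⟪v, r⟫ ∧ gwSgn ⟪v, r⟫ = gwSgn ⟪w, r⟫}
      = ENNReal.ofReal (1 - (1 / (2 * Real.pi)) *
          (Real.arccos ⟪u, v⟫ + Real.arccos ⟪u, w⟫ + Real.arccos ⟪v, w⟫)) := by
  have h0 : σ {0} = 0 := measure_mono_null (by simp) hσsupp
  have hdim : 2 ≤ Module.finrank ℝ (EuclideanSpace ℝ (Fin n)) := by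
    rwa [finrank_euclideanSpace_fin]
  have huv := measureReal_separatingSet hdim h0 hσinv hu hv
  have huw := measureReal_separatingSet hdim h0 hσinv hu hw
  have hvw := measureReal_separatingSet hdim h0 hσinv hv hw
  have hmeas := (measurableSet_separatingSet u v).union (measurableSet_separatingSet v w)
  have hU := measureReal_union_add_inter (μ := σ) (s := separatingSet u v)
    (measurableSet_separatingSet v w)
  have hD := measureReal_sdiff (μ := σ) (s₁ := separatingSet u v ∪ separatingSet v w)
    (s₂ := separatingSet u v ∩ separatingSet v w)
    (Set.inter_subset_left.trans Set.subset_union_left)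
    ((measurableSet_separatingSet u v).inter (measurableSet_separatingSet v w))
  rw [← separatingSet_eq_sdiff] at hD
  have hset : {r | gwSgn ⟪u, r⟫ = gwSgn ⟪v, r⟫ ∧ gwSgn ⟪v, r⟫ = gwSgn ⟪w, r⟫}
      = (separatingSet u v ∪ separatingSet v w)ᶜ := by
    ext r
    simp [separatingSet]
  rw [hset, ← ofReal_measureReal, probReal_compl_eq_one_sub hmeas]
  congr 1
  have hx : σ.real (separatingSet u v ∪ separatingSet v w)
      = (Real.arccos ⟪u, v⟫ / Real.pi + Real.arccos ⟪v, w⟫ / Real.pi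
        + Real.arccos ⟪u, w⟫ / Real.pi) / 2 := by
    linarith
  rw [hx]
  field_simp
  ring
end

section
/- Suppose the n-tuple (û_1,…,û_n) of unit vectors attains Val(RP'-R). Then for every (C,D) ∈ 𝒲: Σ_{i,j,k} [ (2/π)·c_{ijk}·(arccos(⟨û_i,û_j⟩) + arccos(⟨û_i,û_k⟩) − arccos(⟨û_j,û_k⟩)) + 4·d_{ijk}·(1 − (1/(2π))·(arccos(⟨û_i,û_j⟩) + arccos(⟨û_i,û_k⟩) + arccos(⟨û_j,û_k⟩))) ] ≥ 0.79607·Val(RP'). -/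
open Finset RealInnerProductSpace

/-- Objective of the robust Max-DiCut formulation at a ±1 vector `y` and weights `(c, d)`. -/
noncomputable def diCutObjY (n : ℕ) (c d : Fin n → Fin n → Fin n → ℝ) (y : Fin n → ℝ) : ℝ :=
  ∑ i : Fin n, ∑ j : Fin n, ∑ k : Fin n,
    (c i j k * (1 - y i * y j - y i * y k + y j * y k) +
     d i j k * (1 + y i * y j + y i * y k + y j * y k))

/-- Objective of the vector relaxation of robust Max-DiCut at a tuple of vectors `u`. -/
noncomputable def diCutObjU (n : ℕ) (c d : Fin n → Fin n → Fin n → ℝ)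
    (u : Fin n → EuclideanSpace ℝ (Fin n)) : ℝ :=
  ∑ i : Fin n, ∑ j : Fin n, ∑ k : Fin n,
    (c i j k * (1 - ⟪u i, u j⟫ - ⟪u i, u k⟫ + ⟪u j, u k⟫) +
     d i j k * (1 + ⟪u i, u j⟫ + ⟪u i, u k⟫ + ⟪u j, u k⟫))

/-- Expected objective value of the Goemans–Williamson rounding of `(û_i)`
evaluated at weights `(c, d)`. -/
noncomputable def diCutExp (n : ℕ) (c d : Fin n → Fin n → Fin n → ℝ)
    (u : Fin n → EuclideanSpace ℝ (Fin n)) : ℝ :=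
  ∑ i : Fin n, ∑ j : Fin n, ∑ k : Fin n,
    ((2 / Real.pi) * c i j k *
        (Real.arccos ⟪u i, u j⟫ + Real.arccos ⟪u i, u k⟫ - Real.arccos ⟪u j, u k⟫) +
     4 * d i j k * (1 - (1 / (2 * Real.pi)) *
        (Real.arccos ⟪u i, u j⟫ + Real.arccos ⟪u i, u k⟫ + Real.arccos ⟪u j, u k⟫)))

/-- The robust Max-DiCut value Val(RP'). -/
noncomputable def valRP' (n : ℕ)
    (𝒲 : Set ((Fin n → Fin n → Fin n → ℝ) × (Fin n → Fin n → Fin n → ℝ))) : ℝ :=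
  ⨆ y : {y : Fin n → ℝ // ∀ i, y i = 1 ∨ y i = -1}, ⨅ p : 𝒲, diCutObjY n p.1.1 p.1.2 y

/-- A function vanishing at `0` with nonnegative derivative on `[0, ∞)` is nonnegative there. -/
theorem nonneg_of_hasDerivAt_nonneg {f f' : ℝ → ℝ} (hf : ∀ x, HasDerivAt f (f' x) x)
    (h0 : f 0 = 0) (h : ∀ x, 0 ≤ x → 0 ≤ f' x) (x : ℝ) (hx : 0 ≤ x) : 0 ≤ f x := by
  have hmono : MonotoneOn f (Set.Ici 0) := by
    refine monotoneOn_of_deriv_nonneg (convex_Ici 0)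
      (fun y _ => (hf y).continuousAt.continuousWithinAt)
      (fun y _ => (hf y).differentiableAt.differentiableWithinAt) fun y hy => ?_
    rw [interior_Ici] at hy
    rw [(hf y).deriv]
    exact h y (le_of_lt hy)
  rw [← h0]
  exact hmono Set.self_mem_Ici hx hx

theorem hasDerivAt_mul_pow (a : ℝ) (k : ℕ) (x : ℝ) :
    HasDerivAt (fun x : ℝ => a * x ^ k) (a * (k * x ^ (k - 1))) x :=
  (hasDerivAt_pow k x).const_mul a

theorem sub_cube_div_six_le_sin (x : ℝ) (hx : 0 ≤ x) : x - x ^ 3 / 6 ≤ Real.sin x := by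
  have := nonneg_of_hasDerivAt_nonneg (f := fun x => Real.sin x - x + 1 / 6 * x ^ 3)
    (fun x => ((Real.hasDerivAt_sin x).sub (hasDerivAt_id x)).add (hasDerivAt_mul_pow _ 3 x))
    (by simp) (fun x _ => by
      have := Real.one_sub_sq_div_two_le_cos (x := x)
      norm_num
      linarith) x hx
  linarith

theorem cos_le_taylor_four (x : ℝ) (hx : 0 ≤ x) :
    Real.cos x ≤ 1 - x ^ 2 / 2 + x ^ 4 / 24 := by
  have := nonneg_of_hasDerivAt_nonneg
    (f := fun x => -Real.cos x + 1 + -1 / 2 * x ^ 2 + 1 / 24 * x ^ 4)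
    (fun x => ((((Real.hasDerivAt_cos x).neg).add_const 1).add
      (hasDerivAt_mul_pow _ 2 x)).add (hasDerivAt_mul_pow _ 4 x))
    (by simp) (fun x hx => by
      have := sub_cube_div_six_le_sin x hx
      norm_num
      linarith) x hx
  linarith

theorem sin_le_taylor_five (x : ℝ) (hx : 0 ≤ x) :
    Real.sin x ≤ x - x ^ 3 / 6 + x ^ 5 / 120 := by
  have := nonneg_of_hasDerivAt_nonneg
    (f := fun x => -Real.sin x + x + -1 / 6 * x ^ 3 + 1 / 120 * x ^ 5)
    (fun x => ((((Real.hasDerivAt_sin x).neg).add (hasDerivAt_id x)).add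
      (hasDerivAt_mul_pow _ 3 x)).add (hasDerivAt_mul_pow _ 5 x))
    (by simp) (fun x hx => by
      have := cos_le_taylor_four x hx
      norm_num
      linarith) x hx
  linarith

theorem taylor_six_le_cos (x : ℝ) (hx : 0 ≤ x) :
    1 - x ^ 2 / 2 + x ^ 4 / 24 - x ^ 6 / 720 ≤ Real.cos x := by
  have := nonneg_of_hasDerivAt_nonneg
    (f := fun x => Real.cos x - 1 + 1 / 2 * x ^ 2 + -1 / 24 * x ^ 4 + 1 / 720 * x ^ 6)
    (fun x => ((((Real.hasDerivAt_cos x).sub_const 1).add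
      (hasDerivAt_mul_pow _ 2 x)).add (hasDerivAt_mul_pow _ 4 x)).add (hasDerivAt_mul_pow _ 6 x))
    (by simp) (fun x hx => by
      have := sin_le_taylor_five x hx
      norm_num
      linarith) x hx
  linarith

theorem taylor_seven_le_sin (x : ℝ) (hx : 0 ≤ x) :
    x - x ^ 3 / 6 + x ^ 5 / 120 - x ^ 7 / 5040 ≤ Real.sin x := by
  have := nonneg_of_hasDerivAt_nonneg
    (f := fun x => Real.sin x - x + 1 / 6 * x ^ 3 + -1 / 120 * x ^ 5 + 1 / 5040 * x ^ 7)
    (fun x => ((((Real.hasDerivAt_sin x).sub (hasDerivAt_id x)).add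
      (hasDerivAt_mul_pow _ 3 x)).add (hasDerivAt_mul_pow _ 5 x)).add (hasDerivAt_mul_pow _ 7 x))
    (by simp) (fun x hx => by
      have := taylor_six_le_cos x hx
      norm_num
      linarith) x hx
  linarith

theorem cos_le_taylor_eight (x : ℝ) (hx : 0 ≤ x) :
    Real.cos x ≤ 1 - x ^ 2 / 2 + x ^ 4 / 24 - x ^ 6 / 720 + x ^ 8 / 40320 := by
  have := nonneg_of_hasDerivAt_nonneg
    (f := fun x => -Real.cos x + 1 + -1 / 2 * x ^ 2 + 1 / 24 * x ^ 4 + -1 / 720 * x ^ 6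
      + 1 / 40320 * x ^ 8)
    (fun x => ((((((Real.hasDerivAt_cos x).neg).add_const 1).add
      (hasDerivAt_mul_pow _ 2 x)).add (hasDerivAt_mul_pow _ 4 x)).add
      (hasDerivAt_mul_pow _ 6 x)).add (hasDerivAt_mul_pow _ 8 x))
    (by simp) (fun x hx => by
      have := taylor_seven_le_sin x hx
      norm_num
      linarith) x hx
  linarith

theorem two_div_pi_lt : 2 / Real.pi < 0.63661978 := by
  rw [div_lt_iff₀ Real.pi_pos]
  linarith [Real.pi_gt_d20]

theorem lt_two_div_pi : 0.63 < 2 / Real.pi := by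
  rw [lt_div_iff₀ Real.pi_pos]
  linarith [Real.pi_lt_d2]

/-- The polynomial inequality behind the constant `0.79607`: compare with the tangent line
at `s`, which is close to the minimizer. -/
theorem taylor_eight_add_linear_le (x : ℝ) (hx : 0 ≤ x) (hx' : x ≤ 2.36) :
    0.79607 * (1 - x ^ 2 / 2 + x ^ 4 / 24 - x ^ 6 / 720 + x ^ 8 / 40320) + 0.63661978 * x
      ≤ (4 - 0.79607) / 3 := by
  obtain ⟨s, hs⟩ : ∃ s : ℝ, s = 0.92680312 := ⟨_, rfl⟩
  have hx2 : x ^ 2 ≤ 5.5696 := by nlinarith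
  have h35 : x ^ 5 ≤ 5.5696 * x ^ 3 := by nlinarith [pow_nonneg hx 3]
  have h46 : x ^ 6 ≤ 5.5696 * x ^ 4 := by nlinarith [pow_nonneg hx 4]
  have hq : 0 ≤ 1 / 2 - (x ^ 2 + 2 * s * x + 3 * s ^ 2) / 24
      + (x ^ 4 + 2 * s * x ^ 3 + 3 * s ^ 2 * x ^ 2 + 4 * s ^ 3 * x + 5 * s ^ 4) / 720
      - (x ^ 6 + 2 * s * x ^ 5 + 3 * s ^ 2 * x ^ 4 + 4 * s ^ 3 * x ^ 3 + 5 * s ^ 4 * x ^ 2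
        + 6 * s ^ 5 * x + 7 * s ^ 6) / 40320 := by
    rw [hs]
    norm_num
    linarith [pow_nonneg hx 3, pow_nonneg hx 4]
  have htangent : 0.79607 * (1 - s ^ 2 / 2 + s ^ 4 / 24 - s ^ 6 / 720 + s ^ 8 / 40320
      + (-s + s ^ 3 / 6 - s ^ 5 / 120 + s ^ 7 / 5040) * (x - s)) + 0.63661978 * x
      ≤ (4 - 0.79607) / 3 := by
    rw [hs]
    norm_num
    linarith
  linarith [mul_nonneg (sq_nonneg (x - s)) hq]

theorem cos_add_linear_le (x : ℝ) (hx : 0 ≤ x) (hx' : x ≤ 3 * Real.pi / 4) :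
    0.79607 * Real.cos x + 2 / Real.pi * x ≤ (4 - 0.79607) / 3 := by
  have h1 := cos_le_taylor_eight x hx
  have h2 := taylor_eight_add_linear_le x hx (by linarith [Real.pi_lt_d4])
  have h3 := mul_le_mul_of_nonneg_right two_div_pi_lt.le hx
  linarith

/-- The rounding inequality for a triple of angles one of which is close to `π`. -/
theorem rounding_ratio_of_large_angle {a b c : ℝ} (ha : a ≤ Real.pi) (hb : b ≤ Real.pi)
    (hc : c ≤ Real.pi) (hc' : 3 * Real.pi / 4 ≤ c) (hab : c ≤ a + b)
    (hsum : a + b + c ≤ 2 * Real.pi) :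
    0.79607 * (1 + Real.cos a + Real.cos b + Real.cos c) ≤ 4 - 2 / Real.pi * (a + b + c) := by
  obtain ⟨t, ht⟩ : ∃ t, t = a + b - Real.pi := ⟨_, rfl⟩
  obtain ⟨δ, hδ⟩ : ∃ δ, δ = Real.pi - c := ⟨_, rfl⟩
  have hδ1 : δ ≤ 0.79 := by linarith [Real.pi_lt_d4]
  have hrhs : 4 - 2 / Real.pi * (a + b + c) = 2 / Real.pi * (δ - t) := by
    rw [ht, hδ]
    field_simp
    ring
  have hsin : Real.cos a + Real.cos b = -(2 * Real.sin (t / 2) * Real.cos ((a - b) / 2)) := by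
    rw [Real.cos_add_cos, show (a + b) / 2 = t / 2 + Real.pi / 2 by linarith,
      Real.cos_add_pi_div_two]
    ring
  have hcosc : Real.cos c = -Real.cos δ := by rw [hδ, Real.cos_pi_sub, neg_neg]
  have hπ := lt_two_div_pi
  rw [hrhs, hcosc]
  rcases le_total 0 t with h0 | h0
  · have hle : Real.sin (t / 2) ≤ Real.cos ((a - b) / 2) := by
      rw [← Real.cos_pi_div_two_sub, ← Real.cos_abs ((a - b) / 2)]
      refine Real.cos_le_cos_of_nonneg_of_le_pi (abs_nonneg _) (by linarith [Real.pi_pos]) ?_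
      rw [abs_le]
      constructor <;> linarith
    have hnn : 0 ≤ Real.sin (t / 2) :=
      Real.sin_nonneg_of_nonneg_of_le_pi (by linarith) (by linarith [Real.pi_gt_three])
    have hcost : Real.cos t = 1 - 2 * Real.sin (t / 2) ^ 2 := by
      rw [Real.sin_sq_eq_half_sub, mul_div_cancel₀ t two_ne_zero]
      ring
    have h1 : Real.cos a + Real.cos b ≤ Real.cos t - 1 := by
      rw [hsin, hcost]
      nlinarith
    have h2 : Real.cos t - Real.cos δ ≤ (δ + t) / 2 * (δ - t) := by
      have e : Real.cos t - Real.cos δ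
          = 2 * (Real.sin ((δ + t) / 2) * Real.sin ((δ - t) / 2)) := by
        rw [Real.cos_sub_cos, show (t - δ) / 2 = -((δ - t) / 2) by ring, Real.sin_neg,
          add_comm t δ]
        ring
      have := mul_le_mul (Real.sin_le (x := (δ + t) / 2) (by linarith))
        (Real.sin_le (x := (δ - t) / 2) (by linarith))
        (Real.sin_nonneg_of_nonneg_of_le_pi (by linarith) (by linarith [Real.pi_gt_three]))
        (by linarith)
      linarith
    nlinarith [mul_nonneg (show 0 ≤ δ - t by linarith)
      (show 0 ≤ 2 / Real.pi - 0.79607 * ((δ + t) / 2) by linarith)]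
  · have h1 : Real.cos a + Real.cos b ≤ -t := by
      have hs : Real.sin (-t / 2) ≤ -t / 2 := Real.sin_le (by linarith)
      have hs0 : 0 ≤ Real.sin (-t / 2) :=
        Real.sin_nonneg_of_nonneg_of_le_pi (by linarith) (by linarith [Real.pi_gt_three])
      rw [neg_div, Real.sin_neg] at hs hs0
      rw [hsin]
      nlinarith [Real.cos_le_one ((a - b) / 2)]
    have h2 := Real.one_sub_sq_div_two_le_cos (x := δ)
    have h3 := mul_le_mul_of_nonneg_right hπ.le (show 0 ≤ δ - t by linarith)
    nlinarith

theorem rounding_ratio_of_angles {a b c : ℝ} (ha0 : 0 ≤ a) (hb0 : 0 ≤ b) (hc0 : 0 ≤ c)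
    (ha : a ≤ Real.pi) (hb : b ≤ Real.pi) (hc : c ≤ Real.pi)
    (hbc : a ≤ b + c) (hac : b ≤ a + c) (hab : c ≤ a + b) (hsum : a + b + c ≤ 2 * Real.pi) :
    0.79607 * (1 + Real.cos a + Real.cos b + Real.cos c) ≤ 4 - 2 / Real.pi * (a + b + c) := by
  rcases le_total (3 * Real.pi / 4) c with h | hc'
  · exact rounding_ratio_of_large_angle ha hb hc h hab hsum
  rcases le_total (3 * Real.pi / 4) b with h | hb'
  · have := rounding_ratio_of_large_angle ha hc hb h hac (by linarith)
    linarith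
  rcases le_total (3 * Real.pi / 4) a with h | ha'
  · have := rounding_ratio_of_large_angle hb hc ha h hbc (by linarith)
    linarith
  linarith [cos_add_linear_le a ha0 ha', cos_add_linear_le b hb0 hb', cos_add_linear_le c hc0 hc']

section Vectors

variable {V : Type*} [NormedAddCommGroup V] [InnerProductSpace ℝ V]

open InnerProductGeometry in
theorem angle_add_angle_add_angle_le_two_pi (u v w : V) :
    angle u v + angle u w + angle v w ≤ 2 * Real.pi := by
  have := angle_le_angle_add_angle v (-u) w
  rw [angle_neg_right, angle_neg_left, angle_comm v u] at this
  linarith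

/-- The rounding inequality for the event that three unit vectors are on the same side. -/
theorem rounding_ratio_same_side {u v w : V} (hu : ‖u‖ = 1) (hv : ‖v‖ = 1) (hw : ‖w‖ = 1) :
    0.79607 * (1 + ⟪u, v⟫ + ⟪u, w⟫ + ⟪v, w⟫) ≤
      4 - 2 / Real.pi *
        (Real.arccos ⟪u, v⟫ + Real.arccos ⟪u, w⟫ + Real.arccos ⟪v, w⟫) := by
  have hang : ∀ {x y : V}, ‖x‖ = 1 → ‖y‖ = 1 →
      Real.arccos ⟪x, y⟫ = InnerProductGeometry.angle x y := by
    intro x y hx hy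
    simp [InnerProductGeometry.angle, hx, hy]
  have hcos : ∀ {x y : V}, ‖x‖ = 1 → ‖y‖ = 1 →
      ⟪x, y⟫ = Real.cos (InnerProductGeometry.angle x y) := by
    intro x y hx hy
    simp [InnerProductGeometry.cos_angle, hx, hy]
  rw [hang hu hv, hang hu hw, hang hv hw, hcos hu hv, hcos hu hw, hcos hv hw]
  have h1 := InnerProductGeometry.angle_le_angle_add_angle u v w
  have h2 := InnerProductGeometry.angle_le_angle_add_angle u w v
  have h3 := InnerProductGeometry.angle_le_angle_add_angle v u w
  rw [InnerProductGeometry.angle_comm w v] at h2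
  rw [InnerProductGeometry.angle_comm v u] at h3
  exact rounding_ratio_of_angles (InnerProductGeometry.angle_nonneg _ _)
    (InnerProductGeometry.angle_nonneg _ _) (InnerProductGeometry.angle_nonneg _ _)
    (InnerProductGeometry.angle_le_pi _ _) (InnerProductGeometry.angle_le_pi _ _)
    (InnerProductGeometry.angle_le_pi _ _) h2 h1 h3 (angle_add_angle_add_angle_le_two_pi u v w)

/-- The rounding inequality for the event that a unit vector is separated from two others. -/
theorem rounding_ratio_separated {u v w : V} (hu : ‖u‖ = 1) (hv : ‖v‖ = 1) (hw : ‖w‖ = 1) :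
    0.79607 * (1 - ⟪u, v⟫ - ⟪u, w⟫ + ⟪v, w⟫) ≤
      2 / Real.pi *
        (Real.arccos ⟪u, v⟫ + Real.arccos ⟪u, w⟫ - Real.arccos ⟪v, w⟫) := by
  have h := rounding_ratio_same_side ((norm_neg u).trans hu) hv hw
  simp only [inner_neg_left, Real.arccos_neg] at h
  have e : 2 / Real.pi * (2 * Real.pi) = 4 := by
    field_simp
    norm_num
  linarith

end Vectors

theorem mul_diCutObjU_le_diCutExp {n : ℕ} {c d : Fin n → Fin n → Fin n → ℝ}
    (hcd : ∀ i j k, 0 ≤ c i j k ∧ 0 ≤ d i j k) {u : Fin n → EuclideanSpace ℝ (Fin n)}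
    (hu : ∀ i, ‖u i‖ = 1) : 0.79607 * diCutObjU n c d u ≤ diCutExp n c d u := by
  unfold diCutObjU diCutExp
  simp only [Finset.mul_sum]
  refine Finset.sum_le_sum fun i _ => Finset.sum_le_sum fun j _ => Finset.sum_le_sum fun k _ => ?_
  have h1 := mul_le_mul_of_nonneg_left (rounding_ratio_separated (hu i) (hu j) (hu k))
    (hcd i j k).1
  have h2 := mul_le_mul_of_nonneg_left (rounding_ratio_same_side (hu i) (hu j) (hu k))
    (hcd i j k).2
  have e : 1 / (2 * Real.pi) = 2 / Real.pi / 4 := by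
    field_simp
    norm_num
  rw [e]
  linarith

/-- A ±1 assignment is a feasible point of the vector relaxation with the same objective value. -/
theorem diCutObjU_smul {n : ℕ} (c d : Fin n → Fin n → Fin n → ℝ) (y : Fin n → ℝ)
    {e : EuclideanSpace ℝ (Fin n)} (he : ‖e‖ = 1) :
    diCutObjU n c d (fun i => y i • e) = diCutObjY n c d y := by
  simp [diCutObjU, diCutObjY, real_inner_smul_left, real_inner_smul_right, he, mul_comm]

/-- If `(û_i)` attains Val(RP'-R), then the expected rounded objective value is at least
`0.79607 · Val(RP')` for every `(c, d) ∈ 𝒲`. -/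
theorem robust_dicut_approx (n : ℕ) (hn : 1 ≤ n)
    (𝒲 : Set ((Fin n → Fin n → Fin n → ℝ) × (Fin n → Fin n → Fin n → ℝ)))
    (hne : 𝒲.Nonempty)
    (hnonneg : ∀ p ∈ 𝒲, ∀ i j k, 0 ≤ p.1 i j k ∧ 0 ≤ p.2 i j k)
    (hbddY : ∀ y : Fin n → ℝ, BddBelow (Set.range fun p : 𝒲 => diCutObjY n p.1.1 p.1.2 y))
    (hbddU : ∀ u : Fin n → EuclideanSpace ℝ (Fin n),
      BddBelow (Set.range fun p : 𝒲 => diCutObjU n p.1.1 p.1.2 u))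
    (hbddSupY : BddAbove (Set.range fun y : {y : Fin n → ℝ // ∀ i, y i = 1 ∨ y i = -1} =>
      ⨅ p : 𝒲, diCutObjY n p.1.1 p.1.2 y))
    (hbddSupU : BddAbove
      (Set.range fun u : {u : Fin n → EuclideanSpace ℝ (Fin n) // ∀ i, ‖u i‖ = 1} =>
        ⨅ p : 𝒲, diCutObjU n p.1.1 p.1.2 u))
    (uhat : Fin n → EuclideanSpace ℝ (Fin n)) (huhat : ∀ i, ‖uhat i‖ = 1)
    (hatt : (⨅ p : 𝒲, diCutObjU n p.1.1 p.1.2 uhat)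
      = ⨆ u : {u : Fin n → EuclideanSpace ℝ (Fin n) // ∀ i, ‖u i‖ = 1},
          ⨅ p : 𝒲, diCutObjU n p.1.1 p.1.2 u) :
    ∀ p ∈ 𝒲, diCutExp n p.1 p.2 uhat ≥ 0.79607 * valRP' n 𝒲 := by
  intro p hp
  have hval : valRP' n 𝒲 ≤ ⨅ p : 𝒲, diCutObjU n p.1.1 p.1.2 uhat := by
    rw [hatt]
    have : Nonempty {y : Fin n → ℝ // ∀ i, y i = 1 ∨ y i = -1} :=
      ⟨⟨fun _ => 1, fun _ => Or.inl rfl⟩⟩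
    refine ciSup_le fun y => ?_
    have he : ‖EuclideanSpace.single (⟨0, hn⟩ : Fin n) (1 : ℝ)‖ = 1 := by simp
    have hunit : ∀ i, ‖y.1 i • EuclideanSpace.single (⟨0, hn⟩ : Fin n) (1 : ℝ)‖ = 1 := by
      intro i
      rw [norm_smul, he]
      rcases y.2 i with h | h <;> simp [h]
    refine le_trans (le_of_eq ?_) (le_ciSup hbddSupU ⟨_, hunit⟩)
    simp only [diCutObjU_smul _ _ _ he]
  have hinf := ciInf_le (hbddU uhat) ⟨p, hp⟩
  have := mul_diCutObjU_le_diCutExp (hnonneg p hp) huhat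
  linarith
end

section
/- Suppose the n-tuple (û_1,…,û_n) of unit vectors attains Val(AE-R), and suppose ẑ ∈ {−1,1}^n satisfies, for every w ∈ 𝒲, Σ_{C ∈ S} w_C·(Σ_{i ∈ I_C} ε_{C,i}·ẑ_i)² ≥ (2/π)·Σ_{C ∈ S} w_C·‖Σ_{i ∈ I_C} ε_{C,i}·û_i‖². For each clause C define P(C) = Π_{i ∈ I_C} (1 + √(2/k)·ε_{C,i}·ẑ_i)/2 + Π_{i ∈ I_C} (1 − √(2/k)·ε_{C,i}·ẑ_i)/2 (the probability that C is satisfied when each x_i is independently set to 1 with probability (1 + √(2/k)·ẑ_i)/2). Then for every w ∈ 𝒲: Σ_{C ∈ S} w_C·P(C) ≥ 0.88·(k/2^k)·Val(AE). -/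
open Finset RealInnerProductSpace

open Classical in
/-- Weighted count of satisfied clauses: `Σ_{C ∈ S} w_C · 1[x satisfies C]`, where a
clause `C` has index set `I C`, signs `ε C`, and is satisfied by `x ∈ {−1,1}^n` when
`i ↦ ε_{C,i} x_i` is constant on `I C`. -/
noncomputable def aeObjX (n : ℕ) (S : Type) [Fintype S]
    (I : S → Finset (Fin n)) (ε : S → Fin n → ℝ) (w : S → ℝ) (x : Fin n → ℝ) : ℝ :=
  ∑ C : S, w C * (if ∀ i ∈ I C, ∀ j ∈ I C, ε C i * x i = ε C j * x j then 1 else 0)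

/-- Relaxed clause objective: `Σ_{C ∈ S} w_C · ‖Σ_{i ∈ I_C} ε_{C,i} u_i‖²`. -/
noncomputable def aeObjU (n : ℕ) (S : Type) [Fintype S]
    (I : S → Finset (Fin n)) (ε : S → Fin n → ℝ) (w : S → ℝ)
    (u : Fin n → EuclideanSpace ℝ (Fin n)) : ℝ :=
  ∑ C : S, w C * ‖∑ i ∈ I C, ε C i • u i‖ ^ 2

/-- The robust Max k-AllEqual value Val(AE). -/
noncomputable def valAE (n : ℕ) (S : Type) [Fintype S]
    (I : S → Finset (Fin n)) (ε : S → Fin n → ℝ) (𝒲 : Set (S → ℝ)) : ℝ :=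
  ⨆ x : {x : Fin n → ℝ // ∀ i, x i = 1 ∨ x i = -1}, ⨅ w : 𝒲, aeObjX n S I ε w x

/-- Probability that clause `C` is satisfied by the Charikar–Wirth randomized rounding
of the sign vector `z`:
`Π_{i ∈ I_C} (1 + √(2/k) ε_{C,i} z_i)/2 + Π_{i ∈ I_C} (1 − √(2/k) ε_{C,i} z_i)/2`. -/
noncomputable def aeProb (n k : ℕ) (S : Type)
    (I : S → Finset (Fin n)) (ε : S → Fin n → ℝ) (z : Fin n → ℝ) (C : S) : ℝ :=
  (∏ i ∈ I C, (1 + Real.sqrt (2 / (k : ℝ)) * ε C i * z i) / 2) +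
  (∏ i ∈ I C, (1 - Real.sqrt (2 / (k : ℝ)) * ε C i * z i) / 2)

/-- The quadratic lower bound `0.9394 s² ≤ cosh s`; the best constant is about `0.93946`. -/
lemma mul_sq_le_cosh (s : ℝ) : 0.9394 * s ^ 2 ≤ Real.cosh s := by
  have h := sum_le_hasSum (Finset.range 6) (fun i _ => by rw [pow_mul]; positivity)
    (Real.hasSum_cosh s)
  norm_num [Finset.sum_range_succ, Nat.factorial] at h
  obtain ⟨t, ht⟩ : ∃ t, t = s ^ 2 := ⟨_, rfl⟩
  have ht0 : 0 ≤ t := ht ▸ sq_nonneg s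
  have e4 : s ^ 4 = t ^ 2 := by rw [ht]; ring
  have e6 : s ^ 6 = t ^ 3 := by rw [ht]; ring
  have e8 : s ^ 8 = t ^ 4 := by rw [ht]; ring
  have e10 : s ^ 10 = t ^ 5 := by rw [ht]; ring
  rw [e4, e6, e8, e10, ← ht] at h
  rw [← ht]
  have h2 : 0 ≤ (t - 4.2655) ^ 2 := sq_nonneg _
  have h3 : 0 ≤ (t - 4.2655) ^ 2 * (t + 2 * 4.2655) := by positivity
  have h4 : 0 ≤ (t - 4.2655) ^ 2 * (t ^ 2 + 2 * 4.2655 * t + 3 * 4.2655 ^ 2) := by positivity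
  have h5 : 0 ≤ (t - 4.2655) ^ 2 *
      (t ^ 3 + 2 * 4.2655 * t ^ 2 + 3 * 4.2655 ^ 2 * t + 4 * 4.2655 ^ 3) := by positivity
  ring_nf at h2 h3 h4 h5
  linarith

lemma mul_pi_div_two_le_exp_neg_one : 0.88 * (Real.pi / 2) ≤ 4 * 0.9394 * Real.exp (-1) := by
  have h1 := Real.exp_one_lt_d9
  have h2 := Real.pi_lt_d6
  rw [Real.exp_neg, ← div_eq_mul_inv, le_div_iff₀ (Real.exp_pos 1)]
  nlinarith [Real.pi_pos, Real.exp_pos 1]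

lemma mul_le_log_sub_log {a : ℝ} (ha0 : 0 ≤ a) (ha1 : a < 1) :
    a * (1 + a ^ 2 / 3 + a ^ 4 / 5) ≤ (Real.log (1 + a) - Real.log (1 - a)) / 2 := by
  have h := sum_le_hasSum (Finset.range 3) (fun i _ => by positivity)
    (Real.hasSum_log_sub_log_of_abs_lt_one (abs_lt.2 ⟨by linarith, ha1⟩))
  norm_num [Finset.sum_range_succ] at h
  linarith

lemma neg_one_le_log_one_sub_div_add {y : ℝ} (hy0 : 0 < y) (hy1 : y ≤ 2 / 5) :
    -1 ≤ Real.log (1 - y) / y + 2 * Real.log (1 + (y / 3 + y ^ 2 / 5)) := by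
  have h1 := (abs_le.1 (Real.abs_log_sub_add_sum_range_le
    (abs_lt.2 ⟨by linarith, by linarith⟩ : |y| < 1) 5)).1
  have h2 := Real.le_log_one_add_of_nonneg (by positivity : 0 ≤ y / 3 + y ^ 2 / 5)
  norm_num [Finset.sum_range_succ, abs_of_pos hy0] at h1
  have h3 : y ^ 6 / (1 - y) ≤ y ^ 6 * (5 / 3) := by
    rw [div_le_iff₀ (by linarith)]
    nlinarith [pow_pos hy0 6]
  have h4 : -1 - y / 2 - y ^ 2 / 3 - y ^ 3 / 4 - y ^ 4 / 5 - y ^ 5 * (5 / 3)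
      ≤ Real.log (1 - y) / y := by
    rw [le_div_iff₀ hy0]
    nlinarith
  have h5 : (y / 2 + y ^ 2 / 3 + y ^ 3 / 4 + y ^ 4 / 5 + y ^ 5 * (5 / 3)) / 2
      ≤ 2 * (y / 3 + y ^ 2 / 5) / (y / 3 + y ^ 2 / 5 + 2) := by
    rw [le_div_iff₀ (by positivity)]
    have p2 : y ^ 2 ≤ 2 / 5 * y := by nlinarith
    have p3 : y ^ 3 ≤ 2 / 5 * y ^ 2 := by nlinarith [sq_nonneg y]
    have p4 : y ^ 4 ≤ 2 / 5 * y ^ 3 := by nlinarith [pow_pos hy0 3]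
    have p5 : y ^ 5 ≤ 2 / 5 * y ^ 4 := by nlinarith [pow_pos hy0 4]
    have p6 : y ^ 6 ≤ 2 / 5 * y ^ 5 := by nlinarith [pow_pos hy0 5]
    have p7 : y ^ 7 ≤ 2 / 5 * y ^ 6 := by nlinarith [pow_pos hy0 6]
    nlinarith
  linarith

lemma exp_neg_one_le_mul_sq {a y L : ℝ} (ha0 : 0 < a) (hay : a ^ 2 = y) (hy1 : y ≤ 2 / 5)
    (hL : L = (Real.log (1 + a) - Real.log (1 - a)) / 2) :
    Real.exp (-1) ≤ Real.exp (Real.log (1 - y) / y) * (L ^ 2 / y) := by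
  have hy0 : 0 < y := hay ▸ pow_pos ha0 2
  have hX : 0 < 1 + (y / 3 + y ^ 2 / 5) := by positivity
  have h1 : a * (1 + (y / 3 + y ^ 2 / 5)) ≤ L := by
    have := mul_le_log_sub_log ha0.le (by nlinarith)
    rw [hL, ← hay]
    convert this using 2
    ring
  have h2 : (1 + (y / 3 + y ^ 2 / 5)) ^ 2 ≤ L ^ 2 / y := by
    rw [le_div_iff₀ hy0, ← hay, ← mul_pow, hay, mul_comm]
    exact pow_le_pow_left₀ (by positivity) h1 2
  calc Real.exp (-1)
      ≤ Real.exp (Real.log (1 - y) / y + 2 * Real.log (1 + (y / 3 + y ^ 2 / 5))) :=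
        Real.exp_le_exp.2 (neg_one_le_log_one_sub_div_add hy0 hy1)
    _ = Real.exp (Real.log (1 - y) / y) * (1 + (y / 3 + y ^ 2 / 5)) ^ 2 := by
        rw [Real.exp_add, two_mul, Real.exp_add, Real.exp_log hX, ← sq]
    _ ≤ _ := by gcongr

lemma pow_mul_pow_add_eq_cosh {a : ℝ} (ha0 : 0 ≤ a) (ha1 : a < 1) (p q : ℕ) :
    (1 + a) ^ p * (1 - a) ^ q + (1 - a) ^ p * (1 + a) ^ q =
      2 * Real.exp (((p : ℝ) + q) / 2 * Real.log (1 - a ^ 2)) *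
        Real.cosh (((p : ℝ) - q) * ((Real.log (1 + a) - Real.log (1 - a)) / 2)) := by
  have h1 : 0 < 1 + a := by linarith
  have h2 : 0 < 1 - a := by linarith
  have hlog : Real.log (1 - a ^ 2) = Real.log (1 + a) + Real.log (1 - a) := by
    rw [← Real.log_mul h1.ne' h2.ne']
    congr 1
    ring
  have e (r s : ℕ) : (1 + a) ^ r * (1 - a) ^ s =
      Real.exp (r * Real.log (1 + a) + s * Real.log (1 - a)) := by
    rw [Real.exp_add, Real.exp_nat_mul, Real.exp_nat_mul, Real.exp_log h1, Real.exp_log h2]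
  rw [mul_comm ((1 - a) ^ p), e p q, e q p, Real.cosh_eq, hlog]
  have key (E x z : ℝ) : 2 * Real.exp E * ((Real.exp x + Real.exp z) / 2) =
      Real.exp (E + x) + Real.exp (E + z) := by
    rw [Real.exp_add, Real.exp_add]
    ring
  rw [key]
  congr 2 <;> ring

lemma le_pow_mul_pow_add_of_five_le {p q k : ℕ} (hk : 5 ≤ k) (hpq : p + q = k) :
    0.88 * (Real.pi / 2) * (((p : ℝ) - q) ^ 2 / k) ≤
      (1 + √(2 / (k : ℝ))) ^ p * (1 - √(2 / (k : ℝ))) ^ q +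
        (1 - √(2 / (k : ℝ))) ^ p * (1 + √(2 / (k : ℝ))) ^ q := by
  have hk' : (5 : ℝ) ≤ k := by exact_mod_cast hk
  have hk0 : (0 : ℝ) < k := by linarith
  have ha2 : √(2 / (k : ℝ)) ^ 2 = 2 / k := Real.sq_sqrt (by positivity)
  have ha0 : 0 < √(2 / (k : ℝ)) := Real.sqrt_pos.2 (by positivity)
  have hy1 : 2 / (k : ℝ) ≤ 2 / 5 := by gcongr
  have ha1 : √(2 / (k : ℝ)) < 1 := by nlinarith
  have hsum : (p : ℝ) + q = k := by exact_mod_cast hpq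
  rw [pow_mul_pow_add_eq_cosh ha0.le ha1, ha2, hsum]
  obtain ⟨L, hL⟩ : ∃ L, L = (Real.log (1 + √(2 / (k : ℝ))) - Real.log (1 - √(2 / (k : ℝ)))) / 2 :=
    ⟨_, rfl⟩
  have h1 := exp_neg_one_le_mul_sq ha0 ha2 hy1 hL
  have hdiv : Real.log (1 - 2 / (k : ℝ)) / (2 / k) = k / 2 * Real.log (1 - 2 / (k : ℝ)) := by
    field_simp
  rw [hdiv] at h1
  rw [← hL]
  obtain ⟨E, hE⟩ : ∃ E, E = Real.exp ((k : ℝ) / 2 * Real.log (1 - 2 / (k : ℝ))) := ⟨_, rfl⟩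
  have hE0 : 0 < E := hE ▸ Real.exp_pos _
  rw [← hE] at h1 ⊢
  calc 0.88 * (Real.pi / 2) * (((p : ℝ) - q) ^ 2 / k)
      ≤ 4 * 0.9394 * Real.exp (-1) * (((p : ℝ) - q) ^ 2 / k) := by
        exact mul_le_mul_of_nonneg_right mul_pi_div_two_le_exp_neg_one (by positivity)
    _ ≤ 4 * 0.9394 * (E * (L ^ 2 / (2 / k))) * (((p : ℝ) - q) ^ 2 / k) := by gcongr
    _ = 2 * E * (0.9394 * (((p : ℝ) - q) * L) ^ 2) := by
        field_simp
        ring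
    _ ≤ _ := by
        gcongr
        exact mul_sq_le_cosh _

lemma le_pow_mul_pow_add {p q k : ℕ} (hk : 2 ≤ k) (hpq : p + q = k) :
    0.88 * (Real.pi / 2) * (((p : ℝ) - q) ^ 2 / k) ≤
      (1 + √(2 / (k : ℝ))) ^ p * (1 - √(2 / (k : ℝ))) ^ q +
        (1 - √(2 / (k : ℝ))) ^ p * (1 + √(2 / (k : ℝ))) ^ q := by
  rcases le_or_gt 5 k with h5 | h5
  · exact le_pow_mul_pow_add_of_five_le h5 hpq
  have hpi := Real.pi_lt_d4
  have ha2 : √(2 / (k : ℝ)) ^ 2 = 2 / k := Real.sq_sqrt (by positivity)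
  obtain ⟨a, ha⟩ : ∃ a, a = √(2 / (k : ℝ)) := ⟨_, rfl⟩
  rw [← ha] at ha2 ⊢
  have ha4 : a ^ 4 = (2 / (k : ℝ)) ^ 2 := by rw [← ha2]; ring
  have hp : p ≤ k := by omega
  obtain rfl : q = k - p := by omega
  clear ha hpq
  interval_cases k <;> interval_cases p <;> norm_num [-sq_eq_one_iff] at ha2 ha4 ⊢ <;>
    ring_nf <;> (try rw [ha4]) <;> (try rw [ha2]) <;> linarith

/-- For signs `s i = ±1`, sums and products of `1 + b * s i` depend only on the number of
positive and negative signs. -/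
lemma exists_card_signs {ι : Type*} (T : Finset ι) (s : ι → ℝ)
    (hs : ∀ i ∈ T, s i = 1 ∨ s i = -1) :
    ∃ p q : ℕ, p + q = #T ∧ ∑ i ∈ T, s i = (p : ℝ) - q ∧
      ∀ b : ℝ, ∏ i ∈ T, (1 + b * s i) = (1 + b) ^ p * (1 - b) ^ q := by
  classical
  induction T using Finset.induction_on with
  | empty => exact ⟨0, 0, by simp⟩
  | insert i T hi ih =>
    obtain ⟨p, q, hc, hsum, hprod⟩ := ih fun j hj => hs j (Finset.mem_insert_of_mem hj)
    rcases hs i (Finset.mem_insert_self i T) with h | h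
    · refine ⟨p + 1, q, ?_, ?_, fun b => ?_⟩
      · rw [Finset.card_insert_of_notMem hi]; omega
      · rw [Finset.sum_insert hi, hsum, h]; push_cast; ring
      · rw [Finset.prod_insert hi, hprod, h]; ring
    · refine ⟨p, q + 1, ?_, ?_, fun b => ?_⟩
      · rw [Finset.card_insert_of_notMem hi]; omega
      · rw [Finset.sum_insert hi, hsum, h]; push_cast; ring
      · rw [Finset.prod_insert hi, hprod, h]; ring

lemma le_aeProb {n k : ℕ} (hk : 2 ≤ k) {S : Type} {I : S → Finset (Fin n)}
    {ε : S → Fin n → ℝ} {z : Fin n → ℝ} {C : S} (hI : #(I C) = k)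
    (hε : ∀ i ∈ I C, ε C i = 1 ∨ ε C i = -1) (hz : ∀ i, z i = 1 ∨ z i = -1) :
    0.88 * (Real.pi / 2) / (k * 2 ^ k) * (∑ i ∈ I C, ε C i * z i) ^ 2 ≤
      aeProb n k S I ε z C := by
  obtain ⟨p, q, hc, hsum, hprod⟩ := exists_card_signs (I C) (fun i => ε C i * z i) fun i hi => by
    rcases hε i hi with h | h <;> rcases hz i with h' | h' <;> simp [h, h']
  have h1 := le_pow_mul_pow_add hk (hc.trans hI)
  have h2 := hprod (√(2 / (k : ℝ)))
  have h3 := hprod (-√(2 / (k : ℝ)))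
  have hk0 : (0 : ℝ) < k := by positivity
  simp only [neg_mul, ← sub_eq_add_neg, sub_neg_eq_add, ← mul_assoc] at h2 h3
  rw [aeProb, Finset.prod_div_distrib, Finset.prod_div_distrib, Finset.prod_const, hI, h2, h3,
    ← add_div, le_div_iff₀ (by positivity), hsum]
  refine le_of_eq_of_le ?_ h1
  field_simp

/-- An integral assignment `x` embeds in the vector relaxation as `x i • v`, with `v` a fixed unit
vector. -/
lemma mul_aeObjX_le_aeObjU {n k : ℕ} {S : Type} [Fintype S] {I : S → Finset (Fin n)}
    (hI : ∀ C, #(I C) = k) {ε : S → Fin n → ℝ}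
    (hε : ∀ C, ∀ i ∈ I C, ε C i = 1 ∨ ε C i = -1) {w : S → ℝ} (hw : ∀ C, 0 ≤ w C)
    {x : Fin n → ℝ} (hx : ∀ i, x i = 1 ∨ x i = -1) {v : EuclideanSpace ℝ (Fin n)}
    (hv : ‖v‖ = 1) :
    (k : ℝ) ^ 2 * aeObjX n S I ε w x ≤ aeObjU n S I ε w fun i => x i • v := by
  classical
  rw [aeObjX, aeObjU, Finset.mul_sum]
  refine Finset.sum_le_sum fun C _ => ?_
  rw [mul_left_comm]
  refine mul_le_mul_of_nonneg_left ?_ (hw C)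
  split_ifs with h
  · simp only [smul_smul, ← Finset.sum_smul]
    rw [norm_smul, hv, mul_one, mul_one, Real.norm_eq_abs, sq_abs]
    rcases (I C).eq_empty_or_nonempty with h0 | ⟨j, hj⟩
    · simp [h0, ← hI C]
    · rw [Finset.sum_congr rfl fun i hi => h i hi j hj, Finset.sum_const, hI, nsmul_eq_mul, mul_pow]
      rcases hε C j hj with h | h <;> rcases hx j with h' | h' <;> simp [h, h']
  · rw [mul_zero]
    positivity

/-- Approximation guarantee for the robust Max k-AllEqual algorithm: if `(û_i)` attains
Val(AE-R) and `ẑ` is a sign vector satisfying the Charikar–Wirth rounding guarantee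
uniformly over `𝒲`, then for every `w ∈ 𝒲` the expected weighted number of satisfied
clauses is at least `0.88 · (k/2^k) · Val(AE)`. -/
theorem robust_max_k_allequal_approx (n k : ℕ) (hn : 1 ≤ n) (hk : 2 ≤ k)
    (S : Type) [Fintype S]
    (I : S → Finset (Fin n)) (hI : ∀ C, (I C).card = k)
    (ε : S → Fin n → ℝ) (hε : ∀ C, ∀ i ∈ I C, ε C i = 1 ∨ ε C i = -1)
    (𝒲 : Set (S → ℝ)) (hne : 𝒲.Nonempty) (hnonneg : ∀ w ∈ 𝒲, ∀ C, 0 ≤ w C)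
    (hbddX : ∀ x : Fin n → ℝ, BddBelow (Set.range fun w : 𝒲 => aeObjX n S I ε w x))
    (hbddU : ∀ u : Fin n → EuclideanSpace ℝ (Fin n),
      BddBelow (Set.range fun w : 𝒲 => aeObjU n S I ε w u))
    (hbddSupX : BddAbove (Set.range fun x : {x : Fin n → ℝ // ∀ i, x i = 1 ∨ x i = -1} =>
      ⨅ w : 𝒲, aeObjX n S I ε w x))
    (hbddSupU : BddAbove
      (Set.range fun u : {u : Fin n → EuclideanSpace ℝ (Fin n) // ∀ i, ‖u i‖ = 1} =>
        ⨅ w : 𝒲, aeObjU n S I ε w u))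
    (uhat : Fin n → EuclideanSpace ℝ (Fin n)) (huhat : ∀ i, ‖uhat i‖ = 1)
    (hatt : (⨅ w : 𝒲, aeObjU n S I ε w uhat)
      = ⨆ u : {u : Fin n → EuclideanSpace ℝ (Fin n) // ∀ i, ‖u i‖ = 1},
          ⨅ w : 𝒲, aeObjU n S I ε w u)
    (zhat : Fin n → ℝ) (hzhat : ∀ i, zhat i = 1 ∨ zhat i = -1)
    (hround : ∀ w ∈ 𝒲,
      ∑ C : S, w C * (∑ i ∈ I C, ε C i * zhat i) ^ 2
        ≥ (2 / Real.pi) * ∑ C : S, w C * ‖∑ i ∈ I C, ε C i • uhat i‖ ^ 2) :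
    ∀ w ∈ 𝒲, ∑ C : S, w C * aeProb n k S I ε zhat C
      ≥ 0.88 * ((k : ℝ) / 2 ^ k) * valAE n S I ε 𝒲 := by
  intro w hw
  have : Nonempty 𝒲 := hne.to_subtype
  have : Nonempty {x : Fin n → ℝ // ∀ i, x i = 1 ∨ x i = -1} := ⟨⟨fun _ => 1, fun _ => .inl rfl⟩⟩
  have hk0 : (0 : ℝ) < k := by positivity
  have hval : valAE n S I ε 𝒲 ≤ aeObjU n S I ε w uhat / (k : ℝ) ^ 2 := by
    refine ciSup_le fun x => ?_
    let v : EuclideanSpace ℝ (Fin n) := EuclideanSpace.single ⟨0, hn⟩ 1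
    have hv : ‖v‖ = 1 := by simp [v]
    rw [le_div_iff₀ (by positivity), mul_comm]
    have hu (i : Fin n) : ‖x.1 i • v‖ = 1 := by
      rcases x.2 i with h | h <;> simp [h, hv]
    calc (k : ℝ) ^ 2 * ⨅ w : 𝒲, aeObjX n S I ε w x
        ≤ ⨅ w : 𝒲, aeObjU n S I ε w fun i => x.1 i • v :=
          le_ciInf fun w' => (mul_le_mul_of_nonneg_left (ciInf_le (hbddX x) w')
            (by positivity)).trans (mul_aeObjX_le_aeObjU hI hε (hnonneg _ w'.2) x.2 hv)
      _ ≤ ⨅ w : 𝒲, aeObjU n S I ε w uhat := by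
          rw [hatt]
          exact le_ciSup hbddSupU ⟨fun i => x.1 i • v, hu⟩
      _ ≤ aeObjU n S I ε w uhat := ciInf_le (hbddU uhat) ⟨w, hw⟩
  calc 0.88 * ((k : ℝ) / 2 ^ k) * valAE n S I ε 𝒲
      ≤ 0.88 * ((k : ℝ) / 2 ^ k) * (aeObjU n S I ε w uhat / (k : ℝ) ^ 2) := by gcongr
    _ = 0.88 * (Real.pi / 2) / (k * 2 ^ k) * (2 / Real.pi * aeObjU n S I ε w uhat) := by
        have := Real.pi_pos
        field_simp
    _ ≤ 0.88 * (Real.pi / 2) / (k * 2 ^ k) * ∑ C : S, w C * (∑ i ∈ I C, ε C i * zhat i) ^ 2 :=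
        mul_le_mul_of_nonneg_left (hround w hw) (by positivity)
    _ ≤ ∑ C : S, w C * aeProb n k S I ε zhat C := by
        rw [Finset.mul_sum]
        refine Finset.sum_le_sum fun C _ => ?_
        rw [mul_left_comm]
        exact mul_le_mul_of_nonneg_left (le_aeProb hk (hI C) (hε C) hzhat) (hnonneg w hw C)
end

section
/- Suppose the n-tuple (û_1,…,û_n) of unit vectors attains Val(RP-R), assume every W ∈ 𝒲 has W_tot(W) = Σ_{i<j} W_{ij} > 0, define h(t) = arccos(1 − 2t)/π and Ã = inf_{W ∈ 𝒲} [Σ_{i<j} W_{ij}·(1 − ⟨û_i,û_j⟩)/2] / W_tot(W), and suppose Ã ≥ γ, where γ ∈ (0,1) is the solution of h(γ)/γ = α* with α* = min_{0 < θ ≤ π} (2/π)·θ/(1 − cos θ) (numerically γ ≈ 0.84458). Then for every W ∈ 𝒲: Σ_{i<j} W_{ij}·arccos(⟨û_i,û_j⟩)/π ≥ (h(Ã)/Ã)·Val(RP). -/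
open Finset RealInnerProductSpace

/-- Inner (worst-case) objective evaluated at a ±1 vector `y`. -/
noncomputable def cutObjY (n : ℕ) (W : Matrix (Fin n) (Fin n) ℝ) (y : Fin n → ℝ) : ℝ :=
  (1 / 2) * ∑ i : Fin n, ∑ j ∈ Finset.univ.filter (fun j => i < j), W i j * (1 - y i * y j)

/-- Inner objective of the vector relaxation at a tuple of vectors `u`. -/
noncomputable def cutObjU (n : ℕ) (W : Matrix (Fin n) (Fin n) ℝ)
    (u : Fin n → EuclideanSpace ℝ (Fin n)) : ℝ :=
  (1 / 2) * ∑ i : Fin n, ∑ j ∈ Finset.univ.filter (fun j => i < j), W i j * (1 - ⟪u i, u j⟫)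

/-- Expected weight of the Goemans–Williamson rounded cut of `(û_i)` evaluated at `W`. -/
noncomputable def expCut (n : ℕ) (W : Matrix (Fin n) (Fin n) ℝ)
    (u : Fin n → EuclideanSpace ℝ (Fin n)) : ℝ :=
  ∑ i : Fin n, ∑ j ∈ Finset.univ.filter (fun j => i < j),
    W i j * (Real.arccos ⟪u i, u j⟫ / Real.pi)

/-- The robust max-cut value Val(RP). -/
noncomputable def valRP (n : ℕ) (𝒲 : Set (Matrix (Fin n) (Fin n) ℝ)) : ℝ :=
  ⨆ y : {y : Fin n → ℝ // ∀ i, y i = 1 ∨ y i = -1}, ⨅ W : 𝒲, cutObjY n W y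

/-- Total weight `W_tot = Σ_{i<j} W_{ij}`. -/
noncomputable def wTot (n : ℕ) (W : Matrix (Fin n) (Fin n) ℝ) : ℝ :=
  ∑ i : Fin n, ∑ j ∈ Finset.univ.filter (fun j => i < j), W i j

/-- `h(t) = arccos(1 − 2t)/π`. -/
noncomputable def hGW (t : ℝ) : ℝ := Real.arccos (1 - 2 * t) / Real.pi

/-- `Ã = inf_{W ∈ 𝒲} (Σ_{i<j} W_{ij} (1 − ⟨û_i,û_j⟩)/2) / W_tot(W)`. -/
noncomputable def aTilde (n : ℕ) (𝒲 : Set (Matrix (Fin n) (Fin n) ℝ))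
    (u : Fin n → EuclideanSpace ℝ (Fin n)) : ℝ :=
  ⨅ W : 𝒲, (cutObjU n W u) / wTot n W

/-- `α* = min_{0 < θ ≤ π} (2/π)·θ/(1 − cos θ)`. -/
noncomputable def alphaStar : ℝ :=
  ⨅ θ : Set.Ioc (0 : ℝ) Real.pi, (2 / Real.pi) * (θ : ℝ) / (1 - Real.cos (θ : ℝ))

/-- For `π / 2 ≤ a ≤ b`, nonnegativity of `1 - cos x - x * sin x` passes from `a` to `b`. -/
lemma mul_sin_le_one_sub_cos_of_le {a b : ℝ} (ha : Real.pi / 2 ≤ a) (hab : a ≤ b)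
    (hb : b ≤ Real.pi) (h : a * Real.sin a ≤ 1 - Real.cos a) :
    b * Real.sin b ≤ 1 - Real.cos b := by
  have hderiv : ∀ x : ℝ, HasDerivAt (fun x => 1 - Real.cos x - x * Real.sin x)
      (-(x * Real.cos x)) x := by
    intro x
    have h1 := ((Real.hasDerivAt_cos x).const_sub 1).sub
      ((hasDerivAt_id' x).mul (Real.hasDerivAt_sin x))
    exact h1.congr_deriv (by ring)
  have hmono : MonotoneOn (fun x => 1 - Real.cos x - x * Real.sin x)
      (Set.Icc (Real.pi / 2) Real.pi) := by
    refine monotoneOn_of_hasDerivWithinAt_nonneg (convex_Icc _ _)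
      (fun x _ => (hderiv x).continuousAt.continuousWithinAt)
      (fun x _ => (hderiv x).hasDerivWithinAt) ?_
    intro x hx
    rw [interior_Icc] at hx
    have hcos := Real.cos_nonpos_of_pi_div_two_le_of_le hx.1.le
      (by linarith [hx.2, Real.pi_pos] : x ≤ Real.pi + Real.pi / 2)
    nlinarith [hx.1, Real.pi_pos]
  have := hmono ⟨ha, hab.trans hb⟩ ⟨ha.trans hab, hb⟩ hab
  simp only at this
  linarith

/-- Cosine lies above its tangent at `a` on `[π / 2, π]`. -/
lemma cos_tangent_le_of_pi_div_two_le {a x : ℝ} (ha : Real.pi / 2 ≤ a) (ha' : a ≤ Real.pi)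
    (hx : Real.pi / 2 ≤ x) (hx' : x ≤ Real.pi) :
    Real.cos a - (x - a) * Real.sin a ≤ Real.cos x := by
  have hderiv : ∀ z : ℝ, HasDerivAt (fun z => Real.cos z + z * Real.sin a)
      (Real.sin a - Real.sin z) z := by
    intro z
    have h1 := (Real.hasDerivAt_cos z).add ((hasDerivAt_id' z).mul_const (Real.sin a))
    exact h1.congr_deriv (by ring)
  have hanti : ∀ {y z : ℝ}, Real.pi / 2 ≤ y → y ≤ z → z ≤ Real.pi →
      Real.sin z ≤ Real.sin y := by
    intro y z hy hyz hz
    rw [← Real.sin_pi_sub z, ← Real.sin_pi_sub y]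
    exact Real.sin_le_sin_of_le_of_le_pi_div_two (by linarith) (by linarith) (by linarith)
  rcases le_total x a with hxa | hxa
  · have hmono : AntitoneOn (fun z => Real.cos z + z * Real.sin a) (Set.Icc x a) := by
      refine antitoneOn_of_hasDerivWithinAt_nonpos (convex_Icc _ _)
        (fun z _ => (hderiv z).continuousAt.continuousWithinAt)
        (fun z _ => (hderiv z).hasDerivWithinAt) ?_
      intro z hz
      rw [interior_Icc] at hz
      linarith [hanti (hx.trans hz.1.le) hz.2.le ha']
    have := hmono ⟨le_rfl, hxa⟩ ⟨hxa, le_rfl⟩ hxa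
    simp only at this
    linarith
  · have hmono : MonotoneOn (fun z => Real.cos z + z * Real.sin a) (Set.Icc a x) := by
      refine monotoneOn_of_hasDerivWithinAt_nonneg (convex_Icc _ _)
        (fun z _ => (hderiv z).continuousAt.continuousWithinAt)
        (fun z _ => (hderiv z).hasDerivWithinAt) ?_
      intro z hz
      rw [interior_Icc] at hz
      linarith [hanti ha hz.1.le (hz.2.le.trans hx')]
    have := hmono ⟨le_rfl, hxa⟩ ⟨hxa, le_rfl⟩ hxa
    simp only at this
    linarith

/-- If the tangent to cosine at `a ∈ [π / 2, π]` is at most `1` at the origin, then cosine lies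
above this tangent on all of `[0, π]`. -/
lemma cos_tangent_le {a x : ℝ} (ha : Real.pi / 2 ≤ a) (ha' : a ≤ Real.pi)
    (h : a * Real.sin a ≤ 1 - Real.cos a) (hx : 0 ≤ x) (hx' : x ≤ Real.pi) :
    Real.cos a - (x - a) * Real.sin a ≤ Real.cos x := by
  rcases le_total (Real.pi / 2) x with hpx | hpx
  · exact cos_tangent_le_of_pi_div_two_le ha ha' hpx hx'
  · have hpi := Real.pi_pos
    have hmid := cos_tangent_le_of_pi_div_two_le ha ha' le_rfl (by linarith)
    rw [Real.cos_pi_div_two] at hmid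
    have hchord := Real.one_sub_mul_le_cos hx hpx
    set s : ℝ := 2 / Real.pi * x with hs
    have hsx : x = s * (Real.pi / 2) := by rw [hs]; field_simp
    have hs0 : 0 ≤ s := by positivity
    have hs1 : s ≤ 1 := by
      by_contra! hlt
      nlinarith
    have h1 := mul_le_mul_of_nonneg_left hmid hs0
    have h2 := mul_le_mul_of_nonneg_left h (sub_nonneg.2 hs1)
    rw [hsx] at hchord ⊢
    nlinarith

/-- The defining lower bound of the Goemans–Williamson constant. -/
lemma alphaStar_le {θ : ℝ} (h0 : 0 < θ) (hpi : θ ≤ Real.pi) :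
    alphaStar ≤ (2 / Real.pi) * θ / (1 - Real.cos θ) := by
  refine ciInf_le (f := fun θ : Set.Ioc (0 : ℝ) Real.pi =>
    (2 / Real.pi) * (θ : ℝ) / (1 - Real.cos (θ : ℝ))) ⟨0, ?_⟩ ⟨θ, h0, hpi⟩
  rintro _ ⟨⟨x, hx0, hx⟩, rfl⟩
  have := Real.cos_le_one x
  have := Real.pi_pos
  exact div_nonneg (by positivity) (by linarith)

lemma alphaStar_lt_one : alphaStar < 1 := by
  have hpi := Real.pi_pos
  refine (alphaStar_le (θ := Real.pi - Real.pi / 4) (by linarith) (by linarith)).trans_lt ?_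
  rw [Real.cos_pi_sub, Real.cos_pi_div_four]
  have hsqrt : (1.2 : ℝ) < √2 := Real.lt_sqrt_of_sq_lt (by norm_num)
  rw [div_lt_one (by linarith)]
  have : 2 / Real.pi * (Real.pi - Real.pi / 4) = 3 / 2 := by field_simp; norm_num
  linarith

lemma cos_arccos_one_sub_two_mul {t : ℝ} (h0 : 0 ≤ t) (h1 : t ≤ 1) :
    Real.cos (Real.arccos (1 - 2 * t)) = 1 - 2 * t :=
  Real.cos_arccos (by linarith) (by linarith)

/-- A point of `(0, 1)` where `h(γ) / γ = α*` has angle at least `π / 2`, and the tangent to cosine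
at this angle passes below `1` at the origin. -/
lemma critical_angle {γ : ℝ} (h0 : 0 < γ) (h1 : γ < 1) (hγ : hGW γ / γ = alphaStar) :
    Real.pi / 2 ≤ Real.arccos (1 - 2 * γ) ∧
      Real.arccos (1 - 2 * γ) * Real.sin (Real.arccos (1 - 2 * γ)) ≤
        1 - Real.cos (Real.arccos (1 - 2 * γ)) := by
  have hpi := Real.pi_pos
  have hcos := cos_arccos_one_sub_two_mul h0.le h1.le
  set φ := Real.arccos (1 - 2 * γ) with hφ
  have hφ0 : 0 < φ := Real.arccos_pos.2 (by linarith)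
  have hφ1 : φ < Real.pi := by
    refine lt_of_le_of_ne (Real.arccos_le_pi _) fun h => ?_
    rw [h, Real.cos_pi] at hcos
    linarith
  have hval : φ = alphaStar * γ * Real.pi := by
    rw [← hγ, hGW, ← hφ]; field_simp
  constructor
  · by_contra! hlt
    have hchord := Real.one_sub_mul_le_cos hφ0.le hlt.le
    have : 2 / Real.pi * φ = 2 * (alphaStar * γ) := by rw [hval]; field_simp
    nlinarith [alphaStar_lt_one]
  · have hderiv : HasDerivAt (fun θ => θ - alphaStar * Real.pi / 2 * (1 - Real.cos θ))
        (1 - alphaStar * Real.pi / 2 * Real.sin φ) φ := by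
      have := (hasDerivAt_id' φ).sub
        (((Real.hasDerivAt_cos φ).const_sub 1).const_mul (alphaStar * Real.pi / 2))
      exact this.congr_deriv (by ring)
    have hmin : IsLocalMin (fun θ => θ - alphaStar * Real.pi / 2 * (1 - Real.cos θ)) φ := by
      filter_upwards [Ioo_mem_nhds hφ0 hφ1] with θ hθ
      have hlt : Real.cos θ < 1 := by
        have := Real.cos_lt_cos_of_nonneg_of_le_pi le_rfl hθ.2.le hθ.1
        rwa [Real.cos_zero] at this
      have hle := alphaStar_le hθ.1 hθ.2.le
      rw [le_div_iff₀ (by linarith)] at hle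
      have h2 := mul_le_mul_of_nonneg_left hle (by positivity : 0 ≤ Real.pi / 2)
      have h3 : Real.pi / 2 * (2 / Real.pi * θ) = θ := by field_simp
      rw [hcos]
      nlinarith
    have hzero := hmin.hasDerivAt_eq_zero hderiv
    have : φ * Real.sin φ = 2 * γ * (alphaStar * Real.pi / 2 * Real.sin φ) := by
      nth_rewrite 1 [hval]; ring
    rw [this, hcos]
    nlinarith

/-- The relaxation dominates the robust max-cut value. -/
lemma valRP_le_iSup_cutObjU {n : ℕ} (hn : 1 ≤ n) (𝒲 : Set (Matrix (Fin n) (Fin n) ℝ))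
    (hbdd : BddAbove
      (Set.range fun u : {u : Fin n → EuclideanSpace ℝ (Fin n) // ∀ i, ‖u i‖ = 1} =>
        ⨅ W : 𝒲, cutObjU n W u)) :
    valRP n 𝒲 ≤ ⨆ u : {u : Fin n → EuclideanSpace ℝ (Fin n) // ∀ i, ‖u i‖ = 1},
      ⨅ W : 𝒲, cutObjU n W u := by
  have : Nonempty {y : Fin n → ℝ // ∀ i, y i = 1 ∨ y i = -1} := ⟨⟨fun _ => 1, by simp⟩⟩
  refine ciSup_le fun y => ?_
  let e : EuclideanSpace ℝ (Fin n) := EuclideanSpace.single ⟨0, hn⟩ 1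
  have he : ‖e‖ = 1 := by simp [e]
  have hu : ∀ i, ‖y.1 i • e‖ = 1 := by
    intro i
    rw [norm_smul, he]
    rcases y.2 i with h | h <;> simp [h]
  have hinner : ∀ i j, ⟪y.1 i • e, y.1 j • e⟫ = y.1 i * y.1 j := by
    intro i j
    rw [real_inner_smul_left, real_inner_smul_right, real_inner_self_eq_norm_sq, he]
    ring
  refine le_of_eq_of_le ?_ (le_ciSup hbdd ⟨fun i => y.1 i • e, hu⟩)
  simp only [cutObjY, cutObjU, hinner]

lemma cutObjU_le_wTot {n : ℕ} {W : Matrix (Fin n) (Fin n) ℝ} (hW : ∀ i j, 0 ≤ W i j)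
    {u : Fin n → EuclideanSpace ℝ (Fin n)} (hu : ∀ i, ‖u i‖ = 1) :
    cutObjU n W u ≤ wTot n W := by
  rw [cutObjU, wTot, Finset.mul_sum]
  refine Finset.sum_le_sum fun i _ => ?_
  rw [Finset.mul_sum]
  refine Finset.sum_le_sum fun j _ => ?_
  have := neg_one_le_real_inner_of_norm_eq_one (hu i) (hu j)
  nlinarith [hW i j]

lemma inner_mem_Icc_of_norm_eq_one {n : ℕ} {u : Fin n → EuclideanSpace ℝ (Fin n)}
    (hu : ∀ i, ‖u i‖ = 1) (i j : Fin n) : ⟪u i, u j⟫ ∈ Set.Icc (-1 : ℝ) 1 := by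
  have := abs_real_inner_le_norm (u i) (u j)
  rw [hu, hu, one_mul] at this
  exact abs_le.1 this

/-- Integrating a lower bound on the angles that is affine in the inner products. -/
lemma affine_le_mul_expCut {n : ℕ} {W : Matrix (Fin n) (Fin n) ℝ} (hW : ∀ i j, 0 ≤ W i j)
    {u : Fin n → EuclideanSpace ℝ (Fin n)} (hu : ∀ i, ‖u i‖ = 1) {a b s : ℝ}
    (h : ∀ θ, 0 ≤ θ → θ ≤ Real.pi → a + b * (1 - Real.cos θ) ≤ s * θ) :
    a * wTot n W + 2 * b * cutObjU n W u ≤ Real.pi * s * expCut n W u := by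
  simp only [wTot, cutObjU, expCut, Finset.mul_sum, ← Finset.sum_add_distrib]
  refine Finset.sum_le_sum fun i _ => Finset.sum_le_sum fun j _ => ?_
  have hij := h _ (Real.arccos_nonneg ⟪u i, u j⟫) (Real.arccos_le_pi _)
  obtain ⟨h1, h2⟩ := inner_mem_Icc_of_norm_eq_one hu i j
  rw [Real.cos_arccos h1 h2] at hij
  have := mul_le_mul_of_nonneg_left hij (hW i j)
  have h3 : Real.pi * s * (W i j * (Real.arccos ⟪u i, u j⟫ / Real.pi)) =
      W i j * (s * Real.arccos ⟪u i, u j⟫) := by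
    field_simp [Real.pi_pos.ne']
  rw [h3]
  linarith

/-- When the relaxation already cuts the full weight, so does the rounding. -/
lemma wTot_le_expCut_of_wTot_le {n : ℕ} {W : Matrix (Fin n) (Fin n) ℝ}
    (hW : ∀ i j, 0 ≤ W i j) {u : Fin n → EuclideanSpace ℝ (Fin n)} (hu : ∀ i, ‖u i‖ = 1)
    (h : wTot n W ≤ cutObjU n W u) : wTot n W ≤ expCut n W u := by
  have hterm : ∀ i j, 0 ≤ W i j * (1 + ⟪u i, u j⟫) := fun i j =>
    mul_nonneg (hW i j) (by linarith [(inner_mem_Icc_of_norm_eq_one hu i j).1])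
  have hsum : ∑ i : Fin n, ∑ j ∈ Finset.univ.filter (fun j => i < j),
      W i j * (1 + ⟪u i, u j⟫) = 2 * (wTot n W - cutObjU n W u) := by
    simp only [wTot, cutObjU, Finset.mul_sum, ← Finset.sum_sub_distrib]
    exact Finset.sum_congr rfl fun i _ => Finset.sum_congr rfl fun j _ => by ring
  have hzero : ∑ i : Fin n, ∑ j ∈ Finset.univ.filter (fun j => i < j),
      W i j * (1 + ⟪u i, u j⟫) = 0 :=
    le_antisymm (by linarith)
      (Finset.sum_nonneg fun i _ => Finset.sum_nonneg fun j _ => hterm i j)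
  rw [Finset.sum_eq_zero_iff_of_nonneg
    fun i _ => Finset.sum_nonneg fun j _ => hterm i j] at hzero
  refine Finset.sum_le_sum fun i hi => Finset.sum_le_sum fun j hj => ?_
  have hij := (Finset.sum_eq_zero_iff_of_nonneg fun j _ => hterm i j).1 (hzero i hi) j hj
  rcases mul_eq_zero.1 hij with h0 | h0
  · simp [h0]
  · rw [show ⟪u i, u j⟫ = (-1 : ℝ) by linarith, Real.arccos_neg_one,
      div_self Real.pi_pos.ne', mul_one]

/-- Rounding guarantee for a single weight matrix whose normalized relaxation value is at least
`A`, where `A` is beyond the critical point `γ`. -/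
lemma mul_cutObjU_le_expCut {n : ℕ} {W : Matrix (Fin n) (Fin n) ℝ}
    (hW : ∀ i j, 0 ≤ W i j) {u : Fin n → EuclideanSpace ℝ (Fin n)} (hu : ∀ i, ‖u i‖ = 1)
    {γ A : ℝ} (h0 : 0 < γ) (h1 : γ < 1) (hγ : hGW γ / γ = alphaStar) (hγA : γ ≤ A)
    (hA1 : A ≤ 1) (hAW : A * wTot n W ≤ cutObjU n W u) :
    hGW A / A * cutObjU n W u ≤ expCut n W u := by
  have hpi := Real.pi_pos
  have hA0 : 0 < A := h0.trans_le hγA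
  rcases hA1.eq_or_lt with rfl | hA1
  · have hh : hGW 1 = 1 := by
      rw [hGW, show (1 - 2 * 1 : ℝ) = -1 by norm_num, Real.arccos_neg_one, div_self hpi.ne']
    rw [hh, div_one, one_mul]
    exact (cutObjU_le_wTot hW hu).trans (wTot_le_expCut_of_wTot_le hW hu (by linarith))
  obtain ⟨hφγ, hKγ⟩ := critical_angle h0 h1 hγ
  have hφle : Real.arccos (1 - 2 * γ) ≤ Real.arccos (1 - 2 * A) :=
    Real.arccos_le_arccos (by linarith)
  have hK := mul_sin_le_one_sub_cos_of_le hφγ hφle (Real.arccos_le_pi _) hKγ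
  have hcos := cos_arccos_one_sub_two_mul hA0.le hA1.le
  rw [hGW]
  set φ := Real.arccos (1 - 2 * A)
  have hφ : Real.pi / 2 ≤ φ := hφγ.trans hφle
  have hφpi : φ ≤ Real.pi := Real.arccos_le_pi _
  have hφlt : φ < Real.pi := by
    refine lt_of_le_of_ne hφpi fun h => ?_
    rw [h, Real.cos_pi] at hcos
    linarith
  have hsin : 0 < Real.sin φ := Real.sin_pos_of_pos_of_lt_pi (by linarith) hφlt
  have hint := affine_le_mul_expCut hW hu (a := φ * Real.sin φ - 2 * A) (b := 1)
    (s := Real.sin φ) fun θ hθ0 hθ1 => by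
      have := cos_tangent_le hφ hφpi hK hθ0 hθ1
      rw [hcos] at this
      linarith
  rw [hcos] at hK
  have hq : wTot n W ≤ cutObjU n W u / A := by
    rw [le_div_iff₀ hA0]; linarith
  have hC : cutObjU n W u = A * (cutObjU n W u / A) := by field_simp
  have hlhs : Real.pi * Real.sin φ * (φ / Real.pi / A * cutObjU n W u) =
      φ * Real.sin φ * (cutObjU n W u / A) := by field_simp
  refine le_of_mul_le_mul_left (hlhs.trans_le (le_trans ?_ hint)) (mul_pos hpi hsin)
  have := mul_nonneg (sub_nonneg.2 hK) (sub_nonneg.2 hq)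
  linarith

/-- Improved approximation when the maximum cut is large: if `(û_i)` attains Val(RP-R),
all total weights are positive, and `Ã ≥ γ` where `γ ∈ (0,1)` solves `h(γ)/γ = α*`,
then for every `W ∈ 𝒲` the expected rounded cut value is at least `(h(Ã)/Ã)·Val(RP)`. -/
theorem robust_maxcut_large_cut (n : ℕ) (hn : 1 ≤ n)
    (𝒲 : Set (Matrix (Fin n) (Fin n) ℝ)) (hne : 𝒲.Nonempty)
    (hsym : ∀ W ∈ 𝒲, W.IsSymm) (hnonneg : ∀ W ∈ 𝒲, ∀ i j, 0 ≤ W i j)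
    (htot : ∀ W ∈ 𝒲, 0 < wTot n W)
    (hbddY : ∀ y : Fin n → ℝ, BddBelow (Set.range fun W : 𝒲 => cutObjY n W y))
    (hbddU : ∀ u : Fin n → EuclideanSpace ℝ (Fin n),
      BddBelow (Set.range fun W : 𝒲 => cutObjU n W u))
    (hbddSupY : BddAbove (Set.range fun y : {y : Fin n → ℝ // ∀ i, y i = 1 ∨ y i = -1} =>
      ⨅ W : 𝒲, cutObjY n W y))
    (hbddSupU : BddAbove
      (Set.range fun u : {u : Fin n → EuclideanSpace ℝ (Fin n) // ∀ i, ‖u i‖ = 1} =>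
        ⨅ W : 𝒲, cutObjU n W u))
    (uhat : Fin n → EuclideanSpace ℝ (Fin n)) (huhat : ∀ i, ‖uhat i‖ = 1)
    (hatt : (⨅ W : 𝒲, cutObjU n W uhat)
      = ⨆ u : {u : Fin n → EuclideanSpace ℝ (Fin n) // ∀ i, ‖u i‖ = 1},
          ⨅ W : 𝒲, cutObjU n W u)
    (hbddA : BddBelow (Set.range fun W : 𝒲 => (cutObjU n W uhat) / wTot n W))
    (γ : ℝ) (hγ0 : 0 < γ) (hγ1 : γ < 1) (hγeq : hGW γ / γ = alphaStar)
    (hA : aTilde n 𝒲 uhat ≥ γ) :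
    ∀ W ∈ 𝒲, expCut n W uhat
      ≥ (hGW (aTilde n 𝒲 uhat) / aTilde n 𝒲 uhat) * valRP n 𝒲 := by
  intro W hW
  have hA0 : 0 < aTilde n 𝒲 uhat := hγ0.trans_le hA
  have hle : ∀ V ∈ 𝒲, aTilde n 𝒲 uhat ≤ cutObjU n V uhat / wTot n V := fun V hV =>
    ciInf_le hbddA ⟨V, hV⟩
  have hA1 : aTilde n 𝒲 uhat ≤ 1 :=
    (hle W hW).trans ((div_le_one (htot W hW)).2 (cutObjU_le_wTot (hnonneg W hW) huhat))
  have hval : valRP n 𝒲 ≤ cutObjU n W uhat :=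
    ((valRP_le_iSup_cutObjU hn 𝒲 hbddSupU).trans_eq hatt.symm).trans
      (ciInf_le (hbddU uhat) ⟨W, hW⟩)
  have hratio : 0 ≤ hGW (aTilde n 𝒲 uhat) / aTilde n 𝒲 uhat :=
    div_nonneg (div_nonneg (Real.arccos_nonneg _) Real.pi_pos.le) hA0.le
  exact (mul_le_mul_of_nonneg_left hval hratio).trans
    (mul_cutObjU_le_expCut (hnonneg W hW) huhat hγ0 hγ1 hγeq hA hA1
      ((le_div_iff₀ (htot W hW)).1 (hle W hW)))
end

section
/- Suppose the n-tuple (û_1,…,û_n) of unit vectors attains Val(RP-R), where now 𝒲 is a nonempty set of symmetric n×n real matrices whose entries may be negative. For W ∈ 𝒲 let W₋(W) = Σ_{i<j, W_{ij}<0} W_{ij}. Then for every W ∈ 𝒲: Σ_{i<j} W_{ij}·arccos(⟨û_i,û_j⟩)/π − W₋(W) ≥ 0.878·(Val(RP) − W₋(W)). -/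
open Finset RealInnerProductSpace

/-- Sum of the negative weights: `W₋ = Σ_{i<j, W_{ij}<0} W_{ij}`. -/
noncomputable def wNeg (n : ℕ) (W : Matrix (Fin n) (Fin n) ℝ) : ℝ :=
  ∑ i : Fin n, ∑ j ∈ Finset.univ.filter (fun j => i < j ∧ W i j < 0), W i j

/-- The Goemans–Williamson ratio bound in terms of the angle. -/
theorem mul_one_sub_cos_le_div_pi {θ : ℝ} (h0 : 0 ≤ θ) (hπ : θ ≤ Real.pi) :
    0.878 * ((1 - Real.cos θ) / 2) ≤ θ / Real.pi := by
  have hpi := Real.pi_pos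
  rcases le_total θ (Real.pi / 2) with h | h
  · have hcos := Real.one_sub_mul_le_cos h0 h
    have heq : 2 / Real.pi * θ = 2 * (θ / Real.pi) := by ring
    have hnonneg : 0 ≤ θ / Real.pi := by positivity
    linarith
  · obtain ⟨δ, rfl⟩ : ∃ δ, θ = δ + 3 * Real.pi / 4 := ⟨θ - 3 * Real.pi / 4, by ring⟩
    have hpi_gt := Real.pi_gt_d6
    have hpi_lt := Real.pi_lt_d6
    have hlo : -0.8 ≤ δ := by linarith
    have hhi : δ ≤ 0.8 := by linarith
    have habs : |δ| ≤ 1 := abs_le.2 ⟨by linarith, by linarith⟩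
    have hcos := (abs_le.1 (Real.cos_bound habs)).2
    have hsin := (abs_le.1 (Real.sin_bound habs)).2
    have hpow : |δ| ^ 5 ≤ δ ^ 4 := by
      rw [← Even.pow_abs (by decide : Even 4) δ]
      exact pow_le_pow_of_le_one (abs_nonneg δ) habs (by norm_num)
    rw [Even.pow_abs (by decide : Even 4)] at hcos
    have hsum : Real.cos δ + Real.sin δ ≤ 1 + δ - 0.2 * δ ^ 2 := by
      have hq : 0 ≤ δ ^ 2 * (0.3 + δ / 6 - 5 / 48 * δ ^ 2) :=
        mul_nonneg (sq_nonneg δ) (by nlinarith)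
      nlinarith
    have hangle : Real.cos (δ + 3 * Real.pi / 4)
        = -(√2 / 2 * (Real.cos δ + Real.sin δ)) := by
      rw [show δ + 3 * Real.pi / 4 = Real.pi - (Real.pi / 4 - δ) by ring,
        Real.cos_pi_sub, Real.cos_sub, Real.cos_pi_div_four, Real.sin_pi_div_four]
      ring
    have hs : √2 < 1.41422 := by
      rw [Real.sqrt_lt' (by norm_num)]; norm_num
    have hpoly : 0 ≤ 1 + δ - 0.2 * δ ^ 2 := by nlinarith
    have hbound : √2 / 2 * (Real.cos δ + Real.sin δ) ≤ 0.70711 * (1 + δ - 0.2 * δ ^ 2) := by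
      calc _ ≤ √2 / 2 * (1 + δ - 0.2 * δ ^ 2) := by gcongr
        _ ≤ _ := by gcongr; linarith
    rw [hangle, le_div_iff₀ hpi]
    have hfactor : 0.878 * ((1 - -(√2 / 2 * (Real.cos δ + Real.sin δ))) / 2) * Real.pi
        ≤ 0.439 * (1 + 0.70711 * (1 + δ - 0.2 * δ ^ 2)) * Real.pi :=
      mul_le_mul_of_nonneg_right (by linarith) hpi.le
    refine hfactor.trans ?_
    have hlin : (0.0247 : ℝ) ≤ 1 - 0.31042129 * Real.pi ∧
        1 - 0.31042129 * Real.pi ≤ 0.0248 := ⟨by linarith, by linarith⟩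
    have hquad : 0.19 * δ ^ 2 ≤ 0.062084258 * Real.pi * δ ^ 2 := by
      gcongr; linarith
    have hconst : 0.0018 ≤ (0.75 - 0.439 * 1.70711) * Real.pi := by linarith
    have hprod : -0.0248 * |δ| ≤ (1 - 0.31042129 * Real.pi) * δ := by
      have := mul_le_mul_of_nonneg_right hlin.2 (abs_nonneg δ)
      have := neg_abs_le ((1 - 0.31042129 * Real.pi) * δ)
      rw [abs_mul, abs_of_nonneg (by linarith [hlin.1])] at this
      linarith
    have hdisc : 0 ≤ 0.0018 - 0.0248 * |δ| + 0.19 * δ ^ 2 := by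
      rw [← sq_abs δ]
      nlinarith [sq_nonneg (|δ| - 0.065)]
    linarith

/-- The Goemans–Williamson ratio bound in terms of the inner product. -/
theorem mul_one_sub_le_arccos_div_pi {t : ℝ} (h₁ : -1 ≤ t) (h₂ : t ≤ 1) :
    0.878 * ((1 - t) / 2) ≤ Real.arccos t / Real.pi := by
  simpa [Real.cos_arccos h₁ h₂] using
    mul_one_sub_cos_le_div_pi (Real.arccos_nonneg t) (Real.arccos_le_pi t)

theorem mul_one_add_le_one_sub_arccos_div_pi {t : ℝ} (h₁ : -1 ≤ t) (h₂ : t ≤ 1) :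
    0.878 * ((1 + t) / 2) ≤ 1 - Real.arccos t / Real.pi := by
  have h := mul_one_sub_le_arccos_div_pi (t := -t) (by linarith) (by linarith)
  rwa [Real.arccos_neg, sub_div Real.pi, div_self Real.pi_ne_zero, sub_neg_eq_add] at h

/-- The rounding guarantee for a single edge, with its weight `w` of either sign. -/
theorem mul_sub_min_le_arccos (w : ℝ) {t : ℝ} (h₁ : -1 ≤ t) (h₂ : t ≤ 1) :
    0.878 * (1 / 2 * (w * (1 - t)) - min w 0)
      ≤ w * (Real.arccos t / Real.pi) - min w 0 := by
  rcases le_total 0 w with hw | hw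
  · rw [min_eq_right hw]
    linarith [mul_le_mul_of_nonneg_left (mul_one_sub_le_arccos_div_pi h₁ h₂) hw]
  · rw [min_eq_left hw]
    linarith [mul_le_mul_of_nonpos_left (mul_one_add_le_one_sub_arccos_div_pi h₁ h₂) hw]

theorem wNeg_eq_sum_min (n : ℕ) (W : Matrix (Fin n) (Fin n) ℝ) :
    wNeg n W = ∑ i : Fin n, ∑ j ∈ Finset.univ.filter (fun j => i < j), min (W i j) 0 := by
  unfold wNeg
  refine Finset.sum_congr rfl fun i _ => ?_
  rw [← Finset.filter_filter, Finset.sum_filter]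
  refine Finset.sum_congr rfl fun j _ => ?_
  split_ifs with h
  · exact (min_eq_left h.le).symm
  · exact (min_eq_right (not_lt.1 h)).symm

/-- The rounding guarantee for a single weight matrix. -/
theorem mul_cutObjU_sub_wNeg_le (n : ℕ) (W : Matrix (Fin n) (Fin n) ℝ)
    (u : Fin n → EuclideanSpace ℝ (Fin n)) (hu : ∀ i, ‖u i‖ = 1) :
    0.878 * (cutObjU n W u - wNeg n W) ≤ expCut n W u - wNeg n W := by
  rw [wNeg_eq_sum_min]
  unfold cutObjU expCut
  simp only [Finset.mul_sum, ← Finset.sum_sub_distrib]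
  refine Finset.sum_le_sum fun i _ => Finset.sum_le_sum fun j _ => ?_
  have h := abs_le.1 (abs_real_inner_le_norm (u i) (u j))
  rw [hu, hu, one_mul] at h
  exact mul_sub_min_le_arccos (W i j) h.1 h.2

theorem cutObjU_smul (n : ℕ) (W : Matrix (Fin n) (Fin n) ℝ) (y : Fin n → ℝ)
    {e : EuclideanSpace ℝ (Fin n)} (he : ‖e‖ = 1) :
    cutObjU n W (fun i => y i • e) = cutObjY n W y := by
  simp [cutObjU, cutObjY, real_inner_smul_left, real_inner_smul_right, he, mul_comm]

/-- The vector relaxation is an upper bound for the robust max-cut value. -/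
theorem valRP_le_relaxation (n : ℕ) (hn : 1 ≤ n) (𝒲 : Set (Matrix (Fin n) (Fin n) ℝ))
    (hbdd : BddAbove
      (Set.range fun u : {u : Fin n → EuclideanSpace ℝ (Fin n) // ∀ i, ‖u i‖ = 1} =>
        ⨅ W : 𝒲, cutObjU n W u)) :
    valRP n 𝒲 ≤ ⨆ u : {u : Fin n → EuclideanSpace ℝ (Fin n) // ∀ i, ‖u i‖ = 1},
      ⨅ W : 𝒲, cutObjU n W u := by
  have : Nonempty {y : Fin n → ℝ // ∀ i, y i = 1 ∨ y i = -1} := ⟨⟨fun _ => 1, by simp⟩⟩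
  let e : EuclideanSpace ℝ (Fin n) := EuclideanSpace.single ⟨0, hn⟩ 1
  have he : ‖e‖ = 1 := by simp [e]
  refine ciSup_le fun y => ?_
  have hu : ∀ i, ‖y.1 i • e‖ = 1 := fun i => by
    rcases y.2 i with h | h <;> simp [h, he]
  have h := le_ciSup hbdd ⟨fun i => y.1 i • e, hu⟩
  simpa only [cutObjU_smul n _ _ he] using h

/-- Approximation guarantee with arbitrary edge-weight signs: if `(û_i)` attains
Val(RP-R) (with `𝒲` a set of symmetric matrices whose entries may be negative), then
for every `W ∈ 𝒲`,
`E[Ĉ(W)] − W₋(W) ≥ 0.878·(Val(RP) − W₋(W))`. -/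
theorem robust_maxcut_negative_weights (n : ℕ) (hn : 1 ≤ n)
    (𝒲 : Set (Matrix (Fin n) (Fin n) ℝ)) (hne : 𝒲.Nonempty)
    (hsym : ∀ W ∈ 𝒲, W.IsSymm)
    (hbddY : ∀ y : Fin n → ℝ, BddBelow (Set.range fun W : 𝒲 => cutObjY n W y))
    (hbddU : ∀ u : Fin n → EuclideanSpace ℝ (Fin n),
      BddBelow (Set.range fun W : 𝒲 => cutObjU n W u))
    (hbddSupY : BddAbove (Set.range fun y : {y : Fin n → ℝ // ∀ i, y i = 1 ∨ y i = -1} =>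
      ⨅ W : 𝒲, cutObjY n W y))
    (hbddSupU : BddAbove
      (Set.range fun u : {u : Fin n → EuclideanSpace ℝ (Fin n) // ∀ i, ‖u i‖ = 1} =>
        ⨅ W : 𝒲, cutObjU n W u))
    (uhat : Fin n → EuclideanSpace ℝ (Fin n)) (huhat : ∀ i, ‖uhat i‖ = 1)
    (hatt : (⨅ W : 𝒲, cutObjU n W uhat)
      = ⨆ u : {u : Fin n → EuclideanSpace ℝ (Fin n) // ∀ i, ‖u i‖ = 1},
          ⨅ W : 𝒲, cutObjU n W u) :
    ∀ W ∈ 𝒲, expCut n W uhat - wNeg n W ≥ 0.878 * (valRP n 𝒲 - wNeg n W) := by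
  intro W hW
  have hval : valRP n 𝒲 ≤ cutObjU n W uhat :=
    (valRP_le_relaxation n hn 𝒲 hbddSupU).trans
      (hatt ▸ ciInf_le (hbddU uhat) (⟨W, hW⟩ : 𝒲))
  linarith [mul_cutObjU_sub_wNeg_le n W uhat huhat]
end
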